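/- arXiv:2304.10364 — 2 statements merged into one kernel-verified Lean document; each statement's English description precedes it below -/
import Mathlib

section
/- For all indices a, b, c, d ∈ {1,…,N}, the free two-point function satisfies ⟨Φ_{ba} Φ_{dc}⟩_free = (1/V) · δ_{ad} δ_{bc} / (E_{c−1} + E_{d−1} + √(E_{c−1} E_{d−1})), where ⟨f⟩_free = (∫ DΦ f(Φ) exp(−V tr(EΦ² + ½MΦMΦ))) / (∫ DΦ exp(−V tr(EΦ² + ½MΦMΦ))). -/
open MeasureTheory Matrix Polynomial BigOperators

/-- Index set for the strictly-upper-triangular entries. -/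
abbrev OffIdx (N : ℕ) := {p : Fin N × Fin N // p.1 < p.2}

/-- Real coordinates of a Hermitian matrix: the diagonal entries and the
(complex) strictly-upper-triangular entries. -/
abbrev HCoords (N : ℕ) := (Fin N → ℝ) × (OffIdx N → ℂ)

/-- The Hermitian matrix with the given coordinates. -/
noncomputable def hermOf {N : ℕ} (c : HCoords N) : Matrix (Fin N) (Fin N) ℂ :=
  Matrix.of fun i j =>
    if h : i < j then c.2 ⟨(i, j), h⟩
    else if h' : j < i then star (c.2 ⟨(j, i), h'⟩)
    else (c.1 i : ℂ)

/-- The diagonal matrix `M = diag (√E_0, …, √E_{N-1})`. -/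
noncomputable def Mmat (N : ℕ) (Ev : Fin N → ℝ) : Matrix (Fin N) (Fin N) ℂ :=
  Matrix.diagonal fun i => (Real.sqrt (Ev i) : ℂ)

/-- The diagonal matrix `E = diag (E_0, …, E_{N-1})`. -/
noncomputable def Emat (N : ℕ) (Ev : Fin N → ℝ) : Matrix (Fin N) (Fin N) ℂ :=
  Matrix.diagonal fun i => (Ev i : ℂ)

/-- The action `S[Φ] = V tr (EΦ² + κΦ + ½MΦMΦ + √λ MΦ³ + (λ/4)Φ⁴)`. -/
noncomputable def action (N : ℕ) (Vc lam kap : ℝ) (Ev : Fin N → ℝ)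
    (Φ : Matrix (Fin N) (Fin N) ℂ) : ℝ :=
  Vc * (Matrix.trace (Emat N Ev * Φ ^ 2 + (kap : ℂ) • Φ
      + (1 / 2 : ℂ) • (Mmat N Ev * Φ * Mmat N Ev * Φ)
      + ((Real.sqrt lam : ℝ) : ℂ) • (Mmat N Ev * Φ ^ 3)
      + ((lam : ℂ) / 4) • Φ ^ 4)).re

/-- The partition function `Z[J] = ∫ DΦ exp (−S[Φ] + V tr (JΦ))`. -/
noncomputable def Zfun (N : ℕ) (Vc lam kap : ℝ) (Ev : Fin N → ℝ)
    (J : Matrix (Fin N) (Fin N) ℂ) : ℝ :=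
  ∫ c : HCoords N,
    Real.exp (- action N Vc lam kap Ev (hermOf c)
      + Vc * (Matrix.trace (J * hermOf c)).re)

/-- `P(z) = ∫ℝ exp(−(λV/4)x⁴ + Vxz) dx`. -/
noncomputable def Pint (Vc lam : ℝ) (z : ℝ) : ℝ :=
  ∫ x : ℝ, Real.exp (- (lam * Vc / 4) * x ^ 4 + Vc * x * z)

/-- `P_N(s₁,…,s_N) = det (P^{(i−1)}(s_j))`. -/
noncomputable def PNdet (N : ℕ) (Vc lam : ℝ) (s : Fin N → ℝ) : ℝ :=
  Matrix.det (Matrix.of fun i j : Fin N => iteratedDeriv (i : ℕ) (Pint Vc lam) (s j))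

/-- The free action `S_free[Φ] = V tr (EΦ² + ½MΦMΦ)`. -/
noncomputable def freeAction (N : ℕ) (Vc : ℝ) (Ev : Fin N → ℝ)
    (Φ : Matrix (Fin N) (Fin N) ℂ) : ℝ :=
  Vc * (Matrix.trace (Emat N Ev * Φ ^ 2
      + (1 / 2 : ℂ) • (Mmat N Ev * Φ * Mmat N Ev * Φ))).re

theorem hermOf_diag {N : ℕ} (x : HCoords N) (i : Fin N) : hermOf x i i = (x.1 i : ℂ) := by
  simp [hermOf]

theorem hermOf_lt {N : ℕ} (x : HCoords N) {i j : Fin N} (h : i < j) :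
    hermOf x i j = x.2 ⟨(i, j), h⟩ := by
  simp [hermOf, h]

theorem hermOf_gt {N : ℕ} (x : HCoords N) {i j : Fin N} (h : j < i) :
    hermOf x i j = star (x.2 ⟨(j, i), h⟩) := by
  simp [hermOf, h, not_lt_of_gt h]

theorem hermOf_mul_symm {N : ℕ} (x : HCoords N) (i j : Fin N) :
    hermOf x i j * hermOf x j i = ((‖hermOf x i j‖ ^ 2 : ℝ) : ℂ) := by
  rcases lt_trichotomy i j with h | h | h
  · rw [hermOf_lt x h, hermOf_gt x h]
    simp [Complex.mul_conj, Complex.normSq_eq_norm_sq]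
  · subst h
    rw [hermOf_diag, ← Complex.ofReal_mul]
    simp [sq]
  · rw [hermOf_lt x h, hermOf_gt x h, mul_comm]
    simp [Complex.mul_conj, Complex.normSq_eq_norm_sq]

theorem freeAction_eq {N : ℕ} (Vc : ℝ) (Ev : Fin N → ℝ) (x : HCoords N) :
    freeAction N Vc Ev (hermOf x) =
      Vc * ∑ i, ∑ j, (Ev i + 1 / 2 * (Real.sqrt (Ev i) * Real.sqrt (Ev j)))
        * ‖hermOf x i j‖ ^ 2 := by
  have key : Matrix.trace (Emat N Ev * (hermOf x) ^ 2
      + (1 / 2 : ℂ) • (Mmat N Ev * hermOf x * Mmat N Ev * hermOf x)) =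
      ((∑ i, ∑ j, (Ev i + 1 / 2 * (Real.sqrt (Ev i) * Real.sqrt (Ev j)))
        * ‖hermOf x i j‖ ^ 2 : ℝ) : ℂ) := by
    rw [Matrix.trace]
    push_cast
    refine Finset.sum_congr rfl fun i _ => ?_
    simp only [Matrix.diag_apply, Matrix.add_apply, Matrix.smul_apply, Emat, Mmat, sq,
      Matrix.diagonal_mul, Matrix.mul_apply (M := hermOf x), smul_eq_mul]
    rw [Matrix.mul_apply, Finset.mul_sum, Finset.mul_sum, ← Finset.sum_add_distrib]
    refine Finset.sum_congr rfl fun j _ => ?_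
    have := hermOf_mul_symm x i j
    simp only [Matrix.mul_diagonal, Matrix.diagonal_mul]
    push_cast at this
    rw [← sq, ← this]
    ring
  rw [freeAction, key, Complex.ofReal_re]

theorem sum_split {N : ℕ} (F : Fin N → Fin N → ℝ) :
    ∑ i, ∑ j, F i j = ∑ i, F i i + ∑ p : OffIdx N, (F p.1.1 p.1.2 + F p.1.2 p.1.1) := by
  have h1 : ∑ p : OffIdx N, (F p.1.1 p.1.2 + F p.1.2 p.1.1) =
      ∑ i, ∑ j, if i < j then F i j + F j i else 0 := by
    rw [← Fintype.sum_prod_type' (f := fun i j => if i < j then F i j + F j i else 0),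
      ← Finset.sum_filter]
    exact (Finset.sum_subtype (p := fun p : Fin N × Fin N => p.1 < p.2)
      (Finset.univ.filter fun p : Fin N × Fin N => p.1 < p.2) (by simp)
      (fun p => F p.1 p.2 + F p.2 p.1)).symm
  have h2 : ∑ i, ∑ j, (if i < j then F i j + F j i else 0) =
      ∑ i, ∑ j, (if i < j then F i j else 0) + ∑ i, ∑ j, (if j < i then F i j else 0) := by
    rw [Finset.sum_comm (f := fun i j => if j < i then F i j else 0)]
    simp only [← Finset.sum_add_distrib]
    refine Finset.sum_congr rfl fun i _ => Finset.sum_congr rfl fun j _ => ?_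
    split_ifs <;> simp
  have h3 : ∑ i, F i i = ∑ i, ∑ j, (if i = j then F i j else 0) := by simp
  rw [h1, h2, h3]
  simp only [← Finset.sum_add_distrib]
  refine Finset.sum_congr rfl fun i _ => Finset.sum_congr rfl fun j _ => ?_
  rcases lt_trichotomy i j with h | h | h
  · simp [h, h.ne, not_lt_of_gt h]
  · simp [h]
  · simp [h, h.ne', not_lt_of_gt h]

theorem freeAction_split {N : ℕ} (Vc : ℝ) (Ev : Fin N → ℝ) (hE : ∀ i, 0 < Ev i)
    (x : HCoords N) :
    freeAction N Vc Ev (hermOf x) =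
      ∑ i, (3 / 2 * Vc * Ev i) * (x.1 i) ^ 2 +
      ∑ p : OffIdx N, (Vc * (Ev p.1.1 + Ev p.1.2 + Real.sqrt (Ev p.1.1 * Ev p.1.2)))
        * ‖x.2 p‖ ^ 2 := by
  rw [freeAction_eq, sum_split, mul_add, Finset.mul_sum, Finset.mul_sum]
  congr 1
  · refine Finset.sum_congr rfl fun i _ => ?_
    rw [hermOf_diag, Real.mul_self_sqrt (hE i).le, Complex.norm_real, Real.norm_eq_abs, sq_abs]
    ring
  · refine Finset.sum_congr rfl fun p _ => ?_
    obtain ⟨⟨i, j⟩, h⟩ := p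
    simp only
    rw [hermOf_lt x h, hermOf_gt x h, norm_star, Real.sqrt_mul (hE i).le]
    ring

theorem exp_split {N : ℕ} (Vc : ℝ) (Ev : Fin N → ℝ) (hE : ∀ i, 0 < Ev i)
    (x : HCoords N) :
    (Real.exp (- freeAction N Vc Ev (hermOf x)) : ℂ) =
      (∏ i, (Real.exp (-(3 / 2 * Vc * Ev i) * (x.1 i) ^ 2) : ℂ)) *
      ∏ p : OffIdx N, (Real.exp (-(Vc * (Ev p.1.1 + Ev p.1.2 + Real.sqrt (Ev p.1.1 * Ev p.1.2)))
        * ‖x.2 p‖ ^ 2) : ℂ) := by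
  rw [freeAction_split Vc Ev hE x, neg_add, Real.exp_add, ← Finset.sum_neg_distrib,
    ← Finset.sum_neg_distrib, Real.exp_sum, Real.exp_sum]
  push_cast
  simp only [neg_mul]

theorem real_moment0 {b : ℝ} (hb : 0 < b) : ∫ x : ℝ, Real.exp (-b * x ^ 2) ≠ 0 := by
  rw [integral_gaussian]
  positivity

theorem real_moment2 {b : ℝ} (hb : 0 < b) :
    ∫ x : ℝ, x ^ 2 * Real.exp (-b * x ^ 2) = (1 / (2 * b)) * ∫ x : ℝ, Real.exp (-b * x ^ 2) := by
  have h := integral_rpow_mul_exp_neg_mul_rpow (p := 2) (q := 2) (b := b) (by norm_num)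
    (by norm_num) hb
  have h0 := integral_rpow_mul_exp_neg_mul_rpow (p := 2) (q := 0) (b := b) (by norm_num)
    (by norm_num) hb
  have e := integral_comp_abs (f := fun x : ℝ => x ^ 2 * Real.exp (-b * x ^ 2))
  have e0 := integral_comp_abs (f := fun x : ℝ => Real.exp (-b * x ^ 2))
  simp only [sq_abs] at e e0
  simp only [Real.rpow_two, Real.rpow_zero, one_mul] at h h0
  rw [e, e0, h, h0]
  have g : Real.Gamma ((2 + 1) / 2) = (1 / 2) * Real.Gamma ((0 + 1) / 2) := by
    rw [show ((2 : ℝ) + 1) / 2 = (0 + 1) / 2 + 1 by norm_num, Real.Gamma_add_one (by norm_num)]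
    norm_num
  have r : b ^ (-(2 + 1 : ℝ) / 2) = b ^ (-(0 + 1 : ℝ) / 2) * b⁻¹ := by
    rw [← Real.rpow_neg_one, ← Real.rpow_add hb]
    norm_num
  rw [g, r]
  field_simp

theorem cplx_moment0 {b : ℝ} (hb : 0 < b) :
    ∫ z : ℂ, Real.exp (-b * ‖z‖ ^ 2) = Real.pi * b⁻¹ := by
  have h0 := Complex.integral_rpow_mul_exp_neg_mul_rpow (p := 2) (q := 0) (b := b) (by norm_num)
    (by norm_num) hb
  simp only [Real.rpow_two, Real.rpow_zero, one_mul] at h0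
  rw [h0]
  norm_num [Real.rpow_neg_one]

theorem cplx_moment2 {b : ℝ} (hb : 0 < b) :
    ∫ z : ℂ, ‖z‖ ^ 2 * Real.exp (-b * ‖z‖ ^ 2) =
      (1 / b) * ∫ z : ℂ, Real.exp (-b * ‖z‖ ^ 2) := by
  have h := Complex.integral_rpow_mul_exp_neg_mul_rpow (p := 2) (q := 2) (b := b) (by norm_num)
    (by norm_num) hb
  simp only [Real.rpow_two] at h
  rw [h, cplx_moment0 hb]
  rw [show (-(2 + 2 : ℝ) / 2) = -1 + -1 by norm_num, Real.rpow_add hb, Real.rpow_neg_one,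
    show ((2 : ℝ) + 2) / 2 = 1 + 1 by norm_num, Real.Gamma_add_one (by norm_num), Real.Gamma_one]
  field_simp

theorem prod_int {ι κ : Type*} [Fintype ι] [Fintype κ] (f : ι → ℝ → ℂ) (g : κ → ℂ → ℂ) :
    ∫ x : (ι → ℝ) × (κ → ℂ), (∏ i, f i (x.1 i)) * ∏ p, g p (x.2 p) =
      (∏ i, ∫ t, f i t) * ∏ p, ∫ z, g p z := by
  rw [← integral_fintype_prod_volume_eq_prod, ← integral_fintype_prod_volume_eq_prod]
  exact integral_prod_mul (fun y : ι → ℝ => ∏ i, f i (y i)) (fun y : κ → ℂ => ∏ p, g p (y p))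

theorem prod_update {ι : Type*} [Fintype ι] [DecidableEq ι] (f g : ι → ℂ) (i : ι) (r : ℂ)
    (h : g i = r * f i) (h' : ∀ j, j ≠ i → g j = f j) : ∏ j, g j = r * ∏ j, f j := by
  rw [← Finset.mul_prod_erase _ g (Finset.mem_univ i),
    ← Finset.mul_prod_erase _ f (Finset.mem_univ i), h, mul_assoc]
  congr 2
  exact Finset.prod_congr rfl fun j hj => h' j (Finset.ne_of_mem_erase hj)

theorem int_diag {ι κ : Type*} [Fintype ι] [Fintype κ] [DecidableEq ι]
    (f : ι → ℝ → ℂ) (g : κ → ℂ → ℂ) (q : ℝ → ℂ) (i : ι) (r : ℂ)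
    (h : ∫ t, q t * f i t = r * ∫ t, f i t) :
    ∫ x : (ι → ℝ) × (κ → ℂ), q (x.1 i) * ((∏ i, f i (x.1 i)) * ∏ p, g p (x.2 p)) =
      r * ∫ x : (ι → ℝ) × (κ → ℂ), (∏ i, f i (x.1 i)) * ∏ p, g p (x.2 p) := by
  have := prod_int (fun j t => if j = i then q t * f j t else f j t) g
  rw [prod_int f g, ← mul_assoc, ← prod_update (fun j => ∫ t, f j t)
    (fun j => ∫ t, (if j = i then q t * f j t else f j t)) i r (by simpa using h)
    (fun j hj => by simp [hj]), ← this]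
  congr 1
  ext x
  rw [← mul_assoc, ← prod_update (fun j => f j (x.1 j))
    (fun j => (if j = i then q (x.1 j) * f j (x.1 j) else f j (x.1 j))) i (q (x.1 i)) (by simp)
    (fun j hj => by simp [hj])]

theorem int_off {ι κ : Type*} [Fintype ι] [Fintype κ] [DecidableEq κ]
    (f : ι → ℝ → ℂ) (g : κ → ℂ → ℂ) (q : ℂ → ℂ) (i : κ) (r : ℂ)
    (h : ∫ t, q t * g i t = r * ∫ t, g i t) :
    ∫ x : (ι → ℝ) × (κ → ℂ), q (x.2 i) * ((∏ i, f i (x.1 i)) * ∏ p, g p (x.2 p)) =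
      r * ∫ x : (ι → ℝ) × (κ → ℂ), (∏ i, f i (x.1 i)) * ∏ p, g p (x.2 p) := by
  have := prod_int f (fun j t => if j = i then q t * g j t else g j t)
  rw [prod_int f g, mul_left_comm, ← prod_update (fun j => ∫ t, g j t)
    (fun j => ∫ t, (if j = i then q t * g j t else g j t)) i r (by simpa using h)
    (fun j hj => by simp [hj]), ← this]
  congr 1
  ext x
  rw [mul_left_comm, ← prod_update (fun j => g j (x.2 j))
    (fun j => (if j = i then q (x.2 j) * g j (x.2 j) else g j (x.2 j))) i (q (x.2 i)) (by simp)
    (fun j hj => by simp [hj])]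

theorem rot_integral {N : ℕ} (s : Fin N → ℝ ≃ₗᵢ[ℝ] ℝ) (w : OffIdx N → Circle)
    (F : HCoords N → ℂ) :
    ∫ x : HCoords N, F (fun i => s i (x.1 i), fun p => (w p : ℂ) * x.2 p) =
      ∫ x : HCoords N, F x := by
  let e : HCoords N ≃ᵐ HCoords N := MeasurableEquiv.prodCongr
    (MeasurableEquiv.piCongrRight fun i => (s i).toMeasurableEquiv)
    (MeasurableEquiv.piCongrRight fun p => (rotation (w p)).toMeasurableEquiv)
  have he : MeasurePreserving e volume volume :=
    MeasurePreserving.prod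
      (volume_preserving_pi fun i => (s i).measurePreserving)
      (volume_preserving_pi fun p => (rotation (w p)).measurePreserving)
  exact he.integral_comp' F

theorem zero_of_rot {N : ℕ} (Vc : ℝ) (Ev : Fin N → ℝ) (hE : ∀ i, 0 < Ev i)
    (a b c d : Fin N) (s : Fin N → ℝ ≃ₗᵢ[ℝ] ℝ) (w : OffIdx N → Circle) (ω : ℂ) (hω : ω ≠ 1)
    (h : ∀ x : HCoords N, hermOf ((fun i => s i (x.1 i), fun p => (w p : ℂ) * x.2 p) : HCoords N) b a
      * hermOf ((fun i => s i (x.1 i), fun p => (w p : ℂ) * x.2 p) : HCoords N) d c =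
      ω * (hermOf x b a * hermOf x d c)) :
    ∫ x : HCoords N, (hermOf x b a * hermOf x d c)
          * (Real.exp (- freeAction N Vc Ev (hermOf x)) : ℂ) = 0 := by
  have h1 := rot_integral s w (fun x => (hermOf x b a * hermOf x d c)
          * (Real.exp (- freeAction N Vc Ev (hermOf x)) : ℂ))
  have h2 : ∀ x : HCoords N, freeAction N Vc Ev (hermOf
      ((fun i => s i (x.1 i), fun p => (w p : ℂ) * x.2 p) : HCoords N)) =
      freeAction N Vc Ev (hermOf x) := by
    intro x
    rw [freeAction_split Vc Ev hE, freeAction_split Vc Ev hE]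
    have : ∀ i, (s i (x.1 i)) ^ 2 = (x.1 i) ^ 2 := fun i => by
      rw [← sq_abs, ← Real.norm_eq_abs, (s i).norm_map, Real.norm_eq_abs, sq_abs]
    have hw : ∀ p, ‖(w p : ℂ)‖ = 1 := fun p => Circle.norm_coe _
    simp only [this, norm_mul, hw, one_mul]
  simp only [h2, h, mul_assoc ω] at h1
  rw [integral_const_mul] at h1
  have h3 : (ω - 1) * ∫ x : HCoords N, (hermOf x b a * hermOf x d c)
          * (Real.exp (- freeAction N Vc Ev (hermOf x)) : ℂ) = 0 := by
    rw [sub_mul, h1]; ring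
  exact (mul_eq_zero.mp h3).resolve_left (sub_ne_zero.mpr hω)

noncomputable def circI : Circle := ⟨Complex.I, by simp [Submonoid.unitSphere]⟩

theorem zero_case {N : ℕ} (Vc : ℝ) (Ev : Fin N → ℝ) (hE : ∀ i, 0 < Ev i)
    (a b c d : Fin N) (hne : ¬ (a = d ∧ b = c)) :
    ∫ x : HCoords N, (hermOf x b a * hermOf x d c)
          * (Real.exp (- freeAction N Vc Ev (hermOf x)) : ℂ) = 0 := by
  classical
  have hI : (circI : ℂ) = Complex.I := rfl
  have n1 : (-1 : ℂ) ≠ 1 := by norm_num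
  have n2 : Complex.I ≠ 1 := fun h => by simpa using congrArg Complex.re h
  have n3 : -Complex.I ≠ 1 := fun h => by simpa using congrArg Complex.re h
  by_cases hab : b = a
  · subst hab
    refine zero_of_rot Vc Ev hE _ _ _ _
      (fun i => if i = b then LinearIsometryEquiv.neg ℝ else LinearIsometryEquiv.refl ℝ ℝ)
      (fun _ => 1) (-1) n1 fun x => ?_
    rcases lt_trichotomy d c with h | h | h
    · simp [hermOf_diag, hermOf_lt _ h]
    · subst h
      have : d ≠ b := fun h => hne ⟨h.symm, h.symm⟩
      simp [hermOf_diag, this]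
    · simp [hermOf_diag, hermOf_gt _ h]
  · let w : OffIdx N → Circle := fun p => if p.1 = (b, a) ∨ p.1 = (a, b) then circI else 1
    by_cases hdc : d = b ∧ c = a
    · obtain ⟨rfl, rfl⟩ := hdc
      refine zero_of_rot Vc Ev hE _ _ _ _
        (fun i => LinearIsometryEquiv.refl ℝ ℝ) w (-1) n1 fun x => ?_
      rcases lt_or_gt_of_ne hab with h | h
      · simp only [hermOf_lt _ h, w, true_or, if_true, hI]
        linear_combination (x.2 ⟨(d, c), h⟩) ^ 2 * Complex.I_mul_I
      · simp only [hermOf_gt _ h, w, or_true, if_true, hI, star_mul']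
        simp
        linear_combination (starRingEnd ℂ (x.2 ⟨(c, d), h⟩)) ^ 2 * Complex.I_mul_I
    · have key : ∀ x : HCoords N, hermOf ((fun i => LinearIsometryEquiv.refl ℝ ℝ (x.1 i),
          fun p => (w p : ℂ) * x.2 p) : HCoords N) d c = hermOf x d c := by
        intro x
        rcases lt_trichotomy d c with h | h | h
        · have : ¬ ((d, c) = (b, a) ∨ (d, c) = (a, b)) := by grind
          simp only [hermOf_lt _ h, w, if_neg this, Circle.coe_one, one_mul]
        · subst h
          simp [hermOf_diag]
        · have : ¬ ((c, d) = (b, a) ∨ (c, d) = (a, b)) := by grind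
          simp only [hermOf_gt _ h, w, if_neg this, Circle.coe_one, one_mul]
      rcases lt_or_gt_of_ne hab with h | h
      · refine zero_of_rot Vc Ev hE _ _ _ _
          (fun i => LinearIsometryEquiv.refl ℝ ℝ) w Complex.I n2 fun x => ?_
        rw [key]
        simp only [hermOf_lt _ h, w, true_or, if_true, hI, mul_assoc]
      · refine zero_of_rot Vc Ev hE _ _ _ _
          (fun i => LinearIsometryEquiv.refl ℝ ℝ) w (-Complex.I) n3 fun x => ?_
        rw [key]
        simp only [hermOf_gt _ h, w, or_true, if_true, hI, star_mul']
        simp [mul_assoc]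

theorem diag_case {N : ℕ} (Vc : ℝ) (hV : 0 < Vc) (Ev : Fin N → ℝ) (hE : ∀ i, 0 < Ev i)
    (i j : Fin N) :
    ∫ x : HCoords N, (hermOf x i j * hermOf x j i)
          * (Real.exp (- freeAction N Vc Ev (hermOf x)) : ℂ) =
    ((1 / (Vc * (Ev i + Ev j + Real.sqrt (Ev i * Ev j))) : ℝ) : ℂ) *
      ∫ x : HCoords N, (Real.exp (- freeAction N Vc Ev (hermOf x)) : ℂ) := by
  classical
  simp only [exp_split Vc Ev hE]
  have off : ∀ (i j : Fin N) (h : i < j),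
    ∫ x : HCoords N, (hermOf x i j * hermOf x j i)
          * ((∏ i, (Real.exp (-(3 / 2 * Vc * Ev i) * (x.1 i) ^ 2) : ℂ)) *
      ∏ p : OffIdx N, (Real.exp (-(Vc * (Ev p.1.1 + Ev p.1.2 + Real.sqrt (Ev p.1.1 * Ev p.1.2)))
        * ‖x.2 p‖ ^ 2) : ℂ)) =
    ((1 / (Vc * (Ev i + Ev j + Real.sqrt (Ev i * Ev j))) : ℝ) : ℂ) *
      ∫ x : HCoords N, ((∏ i, (Real.exp (-(3 / 2 * Vc * Ev i) * (x.1 i) ^ 2) : ℂ)) *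
      ∏ p : OffIdx N, (Real.exp (-(Vc * (Ev p.1.1 + Ev p.1.2 + Real.sqrt (Ev p.1.1 * Ev p.1.2)))
        * ‖x.2 p‖ ^ 2) : ℂ)) := by
    intro i j h
    simp only [hermOf_mul_symm]
    simp only [hermOf_lt _ h]
    have hb : 0 < Vc * (Ev i + Ev j + Real.sqrt (Ev i * Ev j)) := by
      have := hE i
      have := hE j
      positivity
    refine int_off (fun i t => (Real.exp (-(3 / 2 * Vc * Ev i) * t ^ 2) : ℂ))
      (fun (p : OffIdx N) z => (Real.exp (-(Vc * (Ev p.1.1 + Ev p.1.2 +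
        Real.sqrt (Ev p.1.1 * Ev p.1.2))) * ‖z‖ ^ 2) : ℂ)) (fun z => ((‖z‖ ^ 2 : ℝ) : ℂ))
        ⟨(i, j), h⟩ _ ?_
    simp only [← Complex.ofReal_mul]
    rw [integral_complex_ofReal, integral_complex_ofReal, ← Complex.ofReal_mul,
      cplx_moment2 hb]
  rcases lt_trichotomy i j with h | h | h
  · exact off i j h
  · subst h
    simp only [hermOf_diag]
    have hb : 0 < 3 / 2 * Vc * Ev i := by
      have := hE i
      positivity
    refine int_diag (fun i t => (Real.exp (-(3 / 2 * Vc * Ev i) * t ^ 2) : ℂ))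
      (fun (p : OffIdx N) z => (Real.exp (-(Vc * (Ev p.1.1 + Ev p.1.2 +
        Real.sqrt (Ev p.1.1 * Ev p.1.2))) * ‖z‖ ^ 2) : ℂ)) (fun t => (t : ℂ) * (t : ℂ)) i _ ?_
    simp only [← Complex.ofReal_mul]
    rw [integral_complex_ofReal, integral_complex_ofReal, ← Complex.ofReal_mul]
    simp only [← sq]
    rw [real_moment2 hb, Real.sqrt_sq (hE i).le]
    congr 3
    ring
  · have := off j i h
    rw [add_comm (Ev i), mul_comm (Ev i), ← this]
    congr 1
    ext x
    rw [mul_comm (hermOf x i j)]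

theorem part_ne {N : ℕ} (Vc : ℝ) (hV : 0 < Vc) (Ev : Fin N → ℝ) (hE : ∀ i, 0 < Ev i) :
    ∫ x : HCoords N, (Real.exp (- freeAction N Vc Ev (hermOf x)) : ℂ) ≠ 0 := by
  simp only [exp_split Vc Ev hE]
  have := prod_int (fun i t => (Real.exp (-(3 / 2 * Vc * Ev i) * t ^ 2) : ℂ))
      (fun (p : OffIdx N) z => (Real.exp (-(Vc * (Ev p.1.1 + Ev p.1.2 +
        Real.sqrt (Ev p.1.1 * Ev p.1.2))) * ‖z‖ ^ 2) : ℂ))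
  refine ne_of_eq_of_ne this (mul_ne_zero ?_ ?_)
  · refine Finset.prod_ne_zero_iff.mpr fun i _ => ?_
    have := hE i
    rw [integral_complex_ofReal]
    exact Complex.ofReal_ne_zero.mpr (real_moment0 (by positivity))
  · refine Finset.prod_ne_zero_iff.mpr fun p _ => ?_
    have := hE p.1.1
    have := hE p.1.2
    have hb : 0 < Vc * (Ev p.1.1 + Ev p.1.2 + Real.sqrt (Ev p.1.1 * Ev p.1.2)) := by positivity
    rw [integral_complex_ofReal, cplx_moment0 hb]
    exact Complex.ofReal_ne_zero.mpr (by positivity)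

/-- For all indices `a b c d`, the free two-point function is
`⟨Φ_{ba} Φ_{dc}⟩_free = (1/V) δ_{ad} δ_{bc} / (E_{c−1} + E_{d−1} + √(E_{c−1}E_{d−1}))`. -/
theorem free_propagator
    (N : ℕ) (hN : 1 ≤ N) (Vc : ℝ) (hV : 0 < Vc)
    (Ev : Fin N → ℝ) (hE : ∀ i, 0 < Ev i)
    (a b c d : Fin N) :
    (∫ x : HCoords N, (hermOf x b a * hermOf x d c)
          * (Real.exp (- freeAction N Vc Ev (hermOf x)) : ℂ))
      / (∫ x : HCoords N, (Real.exp (- freeAction N Vc Ev (hermOf x)) : ℂ))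
    = (1 / (Vc : ℂ)) * (if a = d then 1 else 0) * (if b = c then 1 else 0)
        / ((Ev c + Ev d + Real.sqrt (Ev c * Ev d) : ℝ) : ℂ) := by
  by_cases h : a = d ∧ b = c
  · obtain ⟨rfl, rfl⟩ := h
    rw [diag_case Vc hV Ev hE b a, mul_div_assoc, div_self (part_ne Vc hV Ev hE)]
    simp only [if_true]
    push_cast
    rw [mul_one, mul_one, mul_one, div_div]
  · rw [zero_case Vc Ev hE a b c d h, zero_div]
    by_cases h1 : a = d
    · have h2 : b ≠ c := fun h2 => h ⟨h1, h2⟩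
      simp [h2]
    · simp [h1]
end

section
/- Assume E_0, …, E_{N−1} are pairwise distinct and set z_j = E_{j−1}^{3/2}/√λ − κ for j = 1,…,N. For t ∈ ℝ^N let Z_diag(t) = Z[diag(t_1,…,t_N)]. Then for all indices a ≠ b, (∂²/∂t_a ∂t_b) log Z_diag(t) |_{t=0} = − (∂_a P_N)(z)/P_N(z) · (∂_b P_N)(z)/P_N(z) + (∂_a ∂_b P_N)(z)/P_N(z) − λ/(E_{a−1}^{3/2} − E_{b−1}^{3/2})², where z = (z_1,…,z_N) and ∂_a, ∂_b are partial derivatives of P_N in the a-th and b-th arguments. -/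
open MeasureTheory Matrix Polynomial BigOperators

section

theorem herm_conj {N : ℕ} {A B : Matrix (Fin N) (Fin N) ℂ} (hA : A.IsHermitian)
    (hB : B.IsHermitian) (h : A.charpoly = B.charpoly) :
    ∃ U : Matrix (Fin N) (Fin N) ℂ, U * star U = 1 ∧ star U * U = 1 ∧ B = U * A * star U := by
  have he := (Matrix.IsHermitian.eigenvalues_eq_eigenvalues_iff hA hB).2 h
  have h1 := hA.spectral_theorem
  have h2 := hB.spectral_theorem
  rw [Unitary.conjStarAlgAut_apply] at h1 h2
  set UA := hA.eigenvectorUnitary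
  set UB := hB.eigenvectorUnitary
  have a1 : (UA : Matrix (Fin N) (Fin N) ℂ) * star (UA : Matrix (Fin N) (Fin N) ℂ) = 1 :=
    Unitary.mul_star_self_of_mem UA.2
  have a2 : star (UA : Matrix (Fin N) (Fin N) ℂ) * (UA : Matrix (Fin N) (Fin N) ℂ) = 1 :=
    Unitary.star_mul_self_of_mem UA.2
  have b1 : (UB : Matrix (Fin N) (Fin N) ℂ) * star (UB : Matrix (Fin N) (Fin N) ℂ) = 1 :=
    Unitary.mul_star_self_of_mem UB.2
  have b2 : star (UB : Matrix (Fin N) (Fin N) ℂ) * (UB : Matrix (Fin N) (Fin N) ℂ) = 1 :=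
    Unitary.star_mul_self_of_mem UB.2
  rw [← he] at h2
  refine ⟨UB * star (UA : Matrix (Fin N) (Fin N) ℂ), ?_, ?_, ?_⟩
  · rw [star_mul, star_star, mul_assoc, ← mul_assoc _ (UA : Matrix (Fin N) (Fin N) ℂ), a2, one_mul, b1]
  · rw [star_mul, star_star, mul_assoc, ← mul_assoc _ (UB : Matrix (Fin N) (Fin N) ℂ), b2, one_mul, a1]
  · rw [h2]
    generalize (diagonal (RCLike.ofReal ∘ hA.eigenvalues) : Matrix (Fin N) (Fin N) ℂ) = D at *
    rw [h1, star_mul, star_star]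
    simp only [mul_assoc]
    rw [← mul_assoc _ (UA : Matrix (Fin N) (Fin N) ℂ), a2, ← mul_assoc _ (UA : Matrix (Fin N) (Fin N) ℂ), a2]
    simp

theorem charpoly_conj {n : Type*} [Fintype n] [DecidableEq n] {U A : Matrix n n ℂ}
    (hU : star U * U = 1) : (U * A * star U).charpoly = A.charpoly := by
  rw [Matrix.charpoly_mul_comm, ← mul_assoc, hU, one_mul]

noncomputable def border {N : ℕ} (A : Matrix (Fin N) (Fin N) ℂ) (v : Fin N → ℂ) (x : ℝ) :
    Matrix (Fin (N+1)) (Fin (N+1)) ℂ :=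
  Matrix.reindex finSumFinEquiv finSumFinEquiv
    (Matrix.fromBlocks A (Matrix.of fun i (_ : Fin 1) => v i)
      (Matrix.of fun _ i => star (v i)) (Matrix.of fun _ _ => (x : ℂ)))

theorem hermOf_isHermitian {N : ℕ} (c : HCoords N) : (hermOf c).IsHermitian := by
  ext i j
  simp only [hermOf, Matrix.conjTranspose_apply, Matrix.of_apply]
  rcases lt_trichotomy i j with h | h | h
  · simp [h, not_lt_of_gt h]
  · subst h; simp
  · simp [h, not_lt_of_gt h]

theorem border_isHermitian {N : ℕ} {A : Matrix (Fin N) (Fin N) ℂ} (hA : A.IsHermitian)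
    (v : Fin N → ℂ) (x : ℝ) : (border A v x).IsHermitian := by
  unfold border
  rw [Matrix.reindex_apply]
  refine Matrix.IsHermitian.submatrix (Matrix.IsHermitian.fromBlocks hA ?_ ?_) _
  · ext i j; simp
  · ext i j; simp

theorem border_charpoly_conj {N : ℕ} {A U : Matrix (Fin N) (Fin N) ℂ}
    (h1 : U * star U = 1) (h2 : star U * U = 1) (v : Fin N → ℂ) (x : ℝ) :
    (border (U * A * star U) v x).charpoly = (border A (star U *ᵥ v) x).charpoly := by
  unfold border
  rw [Matrix.charpoly_reindex, Matrix.charpoly_reindex]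
  rw [← charpoly_conj (U := Matrix.fromBlocks U 0 0 (1 : Matrix (Fin 1) (Fin 1) ℂ))
    (A := Matrix.fromBlocks A _ _ _)]
  · congr 1
    simp only [star_eq_conjTranspose, Matrix.fromBlocks_conjTranspose, Matrix.fromBlocks_multiply]
    congr 1
    · simp
    · have : (Matrix.of fun i (_ : Fin 1) => (Uᴴ *ᵥ v) i) = Uᴴ * (Matrix.of fun i (_ : Fin 1) => v i) := by
        ext i j; simp [Matrix.mul_apply, Matrix.mulVec, dotProduct]
      rw [this]
      simp only [star_eq_conjTranspose] at h1
      simp [← Matrix.mul_assoc, h1]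
    · have : (Matrix.of fun (_ : Fin 1) i => star ((Uᴴ *ᵥ v) i)) = (Matrix.of fun (_ : Fin 1) i => star (v i)) * U := by
        ext i j; simp [Matrix.mul_apply, Matrix.mulVec, dotProduct, mul_comm]
      rw [this]
      simp only [star_eq_conjTranspose] at h1
      simp [Matrix.mul_assoc, h1]
    · simp
  · simp only [star_eq_conjTranspose, Matrix.fromBlocks_conjTranspose, Matrix.fromBlocks_multiply] at h2 ⊢
    simp [h2]

/-- Splitting of off-diagonal indices. -/
def offFun (N : ℕ) : OffIdx N ⊕ Fin N → OffIdx (N+1)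
  | .inl p => ⟨(p.1.1.castSucc, p.1.2.castSucc), by simpa using p.2⟩
  | .inr i => ⟨(i.castSucc, Fin.last N), Fin.castSucc_lt_last i⟩

theorem offFun_bij (N : ℕ) : Function.Bijective (offFun N) := by
  constructor
  · rintro (⟨⟨i, j⟩, h⟩ | i) (⟨⟨k, l⟩, h'⟩ | k) hh
    · simp [offFun] at hh; simp [hh]
    · simp [offFun, Fin.castSucc_ne_last] at hh
    · simp [offFun, (Fin.castSucc_ne_last _).symm] at hh
    · simp [offFun] at hh; simp [hh]
  · rintro ⟨⟨i, j⟩, h⟩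
    induction j using Fin.lastCases with
    | last =>
      induction i using Fin.lastCases with
      | last => exact absurd h (lt_irrefl _)
      | cast i => exact ⟨.inr i, rfl⟩
    | cast j =>
      induction i using Fin.lastCases with
      | last => exact absurd h (not_lt_of_gt (Fin.castSucc_lt_last j))
      | cast i => exact ⟨.inl ⟨(i, j), by simpa using h⟩, rfl⟩

noncomputable def offEquiv (N : ℕ) : OffIdx N ⊕ Fin N ≃ OffIdx (N+1) :=
  Equiv.ofBijective (offFun N) (offFun_bij N)

noncomputable def joinC {N : ℕ} (q : HCoords N × (ℝ × (Fin N → ℂ))) : HCoords (N+1) :=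
  (Fin.snoc (α := fun _ => ℝ) q.1.1 q.2.1,
    fun p => Sum.elim q.1.2 q.2.2 ((offEquiv N).symm p))

theorem hermOf_joinC {N : ℕ} (c : HCoords N) (x : ℝ) (v : Fin N → ℂ) :
    hermOf (joinC (c, (x, v))) = border (hermOf c) v x := by
  have e1 : ∀ (i j : Fin N) (h : i.castSucc < j.castSucc), (offEquiv N).symm ⟨(i.castSucc, j.castSucc), h⟩
      = .inl ⟨(i, j), by simpa using h⟩ := by
    intro i j h; rw [Equiv.symm_apply_eq]; rfl
  have e2 : ∀ (i : Fin N) (h : i.castSucc < Fin.last N), (offEquiv N).symm ⟨(i.castSucc, Fin.last N), h⟩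
      = .inr i := by
    intro i h; rw [Equiv.symm_apply_eq]; rfl
  have f1 : ∀ i : Fin N, finSumFinEquiv.symm (i.castSucc : Fin (N+1)) = (.inl i : Fin N ⊕ Fin 1) := by
    intro i; rw [Equiv.symm_apply_eq]; rfl
  have f2 : finSumFinEquiv.symm (Fin.last N : Fin (N+1)) = (.inr 0 : Fin N ⊕ Fin 1) := by
    rw [Equiv.symm_apply_eq]; rfl
  ext i j
  simp only [border, Matrix.reindex_apply, Matrix.submatrix_apply]
  induction j using Fin.lastCases with
    | last =>
      induction i using Fin.lastCases with
      | last => simp [hermOf, joinC, f2]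
      | cast i => simp [hermOf, joinC, f1, f2, Fin.castSucc_lt_last, e2]
    | cast j =>
      induction i using Fin.lastCases with
      | last => simp [hermOf, joinC, f1, f2, Fin.castSucc_lt_last, e2, not_lt_of_gt (Fin.castSucc_lt_last j)]
      | cast i => simp [hermOf, joinC, f1, e1]

end

section

theorem measurable_joinC {N : ℕ} : Measurable (joinC (N := N)) := by
  unfold joinC
  refine Measurable.prodMk ?_ ?_
  · rw [measurable_pi_iff]
    intro i
    induction i using Fin.lastCases with
    | last => simp only [Fin.snoc_last]; fun_prop
    | cast i => simp only [Fin.snoc_castSucc]; fun_prop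
  · rw [measurable_pi_iff]
    intro i
    rcases (offEquiv N).symm i with p | j
    · simp only [Sum.elim_inl]; fun_prop
    · simp only [Sum.elim_inr]; fun_prop

theorem lintegral_snoc {N : ℕ} (G : (Fin (N+1) → ℝ) → ENNReal) (hG : Measurable G) :
    ∫⁻ d, G d = ∫⁻ d : Fin N → ℝ, ∫⁻ x : ℝ, G (Fin.snoc (α := fun _ => ℝ) d x) := by
  have h := (volume_preserving_piFinSuccAbove (fun _ : Fin (N+1) => ℝ) (Fin.last N)).symm
  rw [← h.lintegral_comp_emb (MeasurableEquiv.measurableEmbedding _), Measure.volume_eq_prod,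
    lintegral_prod_symm]
  · refine lintegral_congr fun d => lintegral_congr fun x => ?_
    congr 1
    simp [MeasurableEquiv.piFinSuccAbove]
    rfl
  · exact (hG.comp (MeasurableEquiv.measurable _)).aemeasurable

theorem lintegral_off {N : ℕ} (G : (OffIdx (N+1) → ℂ) → ENNReal) (hG : Measurable G) :
    ∫⁻ o, G o = ∫⁻ o : OffIdx N → ℂ, ∫⁻ v : Fin N → ℂ,
      G (fun p => Sum.elim o v ((offEquiv N).symm p)) := by
  have h1 := volume_measurePreserving_piCongrLeft (fun _ : OffIdx (N+1) => ℂ) (offEquiv N)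
  have h2 := volume_measurePreserving_sumPiEquivProdPi_symm (fun _ : OffIdx N ⊕ Fin N => ℂ)
  rw [← h1.lintegral_comp_emb (MeasurableEquiv.measurableEmbedding _),
    ← h2.lintegral_comp_emb (MeasurableEquiv.measurableEmbedding _), Measure.volume_eq_prod,
    lintegral_prod]
  · refine lintegral_congr fun d => lintegral_congr fun x => ?_
    congr 1
    ext p
    obtain ⟨q, rfl⟩ := (offEquiv N).surjective p
    rw [MeasurableEquiv.coe_piCongrLeft, Equiv.piCongrLeft_apply_apply]
    simp only [Equiv.symm_apply_apply]
    rcases q with q | q <;> rfl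
  · exact ((hG.comp (MeasurableEquiv.measurable _)).comp (MeasurableEquiv.measurable _)).aemeasurable

theorem lintegral_joinC {N : ℕ} (F : HCoords (N+1) → ENNReal) (hF : Measurable F) :
    ∫⁻ c, F c = ∫⁻ c : HCoords N, ∫⁻ x : ℝ, ∫⁻ v : Fin N → ℂ, F (joinC (c, (x, v))) := by
  have hm : Measurable fun q : HCoords N × (ℝ × (Fin N → ℂ)) => F (joinC q) := hF.comp measurable_joinC
  rw [Measure.volume_eq_prod, lintegral_prod _ hF.aemeasurable]
  rw [lintegral_snoc _ hF.lintegral_prod_right']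
  rw [Measure.volume_eq_prod (Fin N → ℝ) (OffIdx N → ℂ), lintegral_prod]
  · refine lintegral_congr fun d => ?_
    rw [← lintegral_lintegral_swap (f := fun x o => ∫⁻ v : Fin N → ℂ, F (joinC ((d, o), (x, v))))]
    · refine lintegral_congr fun x => ?_
      rw [lintegral_off]
      · rfl
      · exact hF.comp measurable_prodMk_left
    · apply Measurable.aemeasurable
      have : Measurable fun q : (ℝ × (OffIdx N → ℂ)) × (Fin N → ℂ) =>
          F (joinC ((d, q.1.2), (q.1.1, q.2))) := by
        exact hm.comp (by fun_prop)
      exact this.lintegral_prod_right'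
  · apply Measurable.aemeasurable
    apply Measurable.lintegral_prod_right' (f := fun q : (HCoords N × ℝ) => ∫⁻ v : Fin N → ℂ, F (joinC (q.1, (q.2, v))))
    apply Measurable.lintegral_prod_right' (f := fun q : (HCoords N × ℝ) × (Fin N → ℂ) =>
          F (joinC (q.1.1, (q.1.2, q.2))))
    exact hm.comp (by fun_prop)

theorem lintegral_unitary {N : ℕ} {U : Matrix (Fin N) (Fin N) ℂ} (h1 : star U * U = 1)
    (F : (Fin N → ℂ) → ENNReal) (hF : Measurable F) :
    ∫⁻ v, F (U *ᵥ v) = ∫⁻ v, F v := by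
  set f : (Fin N → ℂ) →ₗ[ℝ] (Fin N → ℂ) := (Matrix.toLin' U).restrictScalars ℝ
  have hd : LinearMap.det f = 1 := by
    rw [LinearMap.det_restrictScalars, LinearMap.det_toLin', Algebra.norm_complex_apply]
    have := congrArg Matrix.det h1
    rw [Matrix.det_mul, star_eq_conjTranspose, Matrix.det_conjTranspose, Matrix.det_one] at this
    have h3 : ((Complex.normSq U.det : ℝ) : ℂ) = 1 := by
      rw [← this, Complex.normSq_eq_conj_mul_self]; rfl
    exact_mod_cast h3
  have hm := Measure.map_linearMap_addHaar_eq_smul_addHaar (volume : Measure (Fin N → ℂ)) (f := f)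
    (by rw [hd]; norm_num)
  rw [hd] at hm
  simp only [inv_one, abs_one, ENNReal.ofReal_one, one_smul] at hm
  have hfm : Measurable f := (LinearMap.continuous_of_finiteDimensional f).measurable
  calc ∫⁻ v, F (U *ᵥ v) = ∫⁻ v, F (f v) := rfl
    _ = _ := by rw [← lintegral_map hF hfm, hm]

theorem normSq_mp : MeasurePreserving (fun z : ℂ => Complex.normSq z) volume
    (ENNReal.ofReal Real.pi • volume.restrict (Set.Ioi (0:ℝ))) := by
  have hmeas : Measurable (fun z : ℂ => Complex.normSq z) := Complex.continuous_normSq.measurable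
  refine ⟨hmeas, ?_⟩
  refine Measure.ext_of_lintegral _ fun g hg => ?_
  rw [lintegral_map hg hmeas, lintegral_smul_measure, ← Complex.lintegral_comp_polarCoord_symm]
  have e1 : ∀ p : ℝ × ℝ, Complex.normSq (Complex.polarCoord.symm p) = p.1 ^ 2 := by
    intro p
    rw [Complex.normSq_eq_norm_sq, Complex.norm_polarCoord_symm, sq_abs]
  simp only [e1]
  have : polarCoord.target = Set.Ioi (0:ℝ) ×ˢ Set.Ioo (-Real.pi) Real.pi := rfl
  rw [this, Measure.volume_eq_prod, ← Measure.prod_restrict, lintegral_prod]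
  swap
  · apply Measurable.aemeasurable
    simp only [smul_eq_mul]
    fun_prop
  simp only [lintegral_const, Measure.restrict_apply_univ, Real.volume_Ioo, smul_eq_mul]
  have him : (fun r : ℝ => r ^ 2) '' Set.Ioi 0 = Set.Ioi 0 := by
    ext y; constructor
    · rintro ⟨r, hr, rfl⟩; exact pow_pos (show (0:ℝ) < r from hr) 2
    · intro hy; exact ⟨Real.sqrt y, Real.sqrt_pos.2 hy, Real.sq_sqrt (le_of_lt hy)⟩
  have hcv := lintegral_image_eq_lintegral_abs_deriv_mul (s := Set.Ioi (0:ℝ)) (f := fun r => r ^ 2)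
    (f' := fun r => 2 * r) measurableSet_Ioi
    (fun x _ => by simpa using (hasDerivAt_pow 2 x).hasDerivWithinAt)
    (fun x hx y hy h => by
      exact (pow_left_inj₀ (le_of_lt hx) (le_of_lt hy) two_ne_zero).1 h) g
  rw [him] at hcv
  rw [hcv, ← lintegral_const_mul']
  · refine setLIntegral_congr_fun measurableSet_Ioi fun r hr => ?_
    have hr' : (0:ℝ) < r := hr
    rw [abs_of_pos (by positivity), show Real.pi - -Real.pi = Real.pi * 2 by ring,
      ENNReal.ofReal_mul Real.pi_pos.le, ENNReal.ofReal_mul (by norm_num : (0:ℝ) ≤ 2)]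
    ring
  · exact ENNReal.ofReal_ne_top

theorem lintegral_normSq {N : ℕ} (F : (Fin N → ℝ) → ENNReal) (hF : Measurable F) :
    ∫⁻ v : Fin N → ℂ, F (fun i => Complex.normSq (v i)) =
      ENNReal.ofReal Real.pi ^ N * ∫⁻ r in Set.univ.pi (fun _ => Set.Ioi (0:ℝ)), F r := by
  have : SigmaFinite (ENNReal.ofReal Real.pi • volume.restrict (Set.Ioi (0:ℝ))) :=
    MeasureTheory.SMul.sigmaFinite (μ := volume.restrict (Set.Ioi (0:ℝ))) Real.pi.toNNReal
  have h := measurePreserving_pi (ι := Fin N) (fun _ => (volume : Measure ℂ))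
    (fun _ => (ENNReal.ofReal Real.pi • volume.restrict (Set.Ioi (0:ℝ)))) (fun _ => normSq_mp)
  have h2 : Measure.pi (fun _ : Fin N => (ENNReal.ofReal Real.pi • volume.restrict (Set.Ioi (0:ℝ))))
    = ENNReal.ofReal Real.pi ^ N • volume.restrict (Set.univ.pi (fun _ : Fin N => Set.Ioi (0:ℝ))) := by
    rw [volume_pi, Measure.restrict_pi_pi]
    refine Measure.pi_eq fun s hs => ?_
    simp [Measure.pi_pi, Finset.prod_mul_distrib]
  rw [h2] at h
  have := h.lintegral_comp hF
  rw [lintegral_smul_measure] at this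
  exact this

end

section

def IL {N : ℕ} (m : Fin N → ℝ) (l : Fin (N+1) → ℝ) : Prop :=
  ∀ i : Fin N, l i.castSucc < m i ∧ m i < l i.succ

theorem IL.strictMono {N : ℕ} {m : Fin N → ℝ} {l : Fin (N+1) → ℝ} (h : IL m l) : StrictMono l :=
  Fin.strictMono_iff_lt_succ.2 fun i => (h i).1.trans (h i).2

theorem IL.strictMono_left {N : ℕ} {m : Fin N → ℝ} {l : Fin (N+1) → ℝ} (h : IL m l) :
    StrictMono m := by
  intro i j hij
  have h1 : l i.succ ≤ l j.castSucc := h.strictMono.monotone (by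
    rw [Fin.le_def]; simp; exact hij)
  exact ((h i).2.trans_le h1).trans (h j).1

noncomputable def Tmap {N : ℕ} (m : Fin N → ℝ) (l : Fin (N+1) → ℝ) : Fin (N+1) → ℝ :=
  Fin.snoc (α := fun _ => ℝ)
    (fun i => -(∏ k, (m i - l k)) / ∏ k ∈ Finset.univ.erase i, (m i - m k))
    (∑ k, l k - ∑ k, m k)

theorem Tmap_pos {N : ℕ} {m : Fin N → ℝ} {l : Fin (N+1) → ℝ} (h : IL m l) (i : Fin N) :
    0 < Tmap m l i.castSucc := by
  have hm := h.strictMono_left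
  simp only [Tmap, Fin.snoc_castSucc]
  rw [Fin.prod_univ_succAbove _ i.castSucc, ← Finset.mul_prod_erase _ _ (Finset.mem_univ i)]
  have e : i.castSucc.succAbove i = i.succ := by simp
  rw [e]
  have : ∀ A B C D : ℝ, -(A * (B * C)) / D = A * (-B) * (C / D) := by intros; ring
  rw [this, ← Finset.prod_div_distrib]
  refine mul_pos (mul_pos ?_ ?_) ?_
  · linarith [(h i).1]
  · linarith [(h i).2]
  · refine Finset.prod_pos fun k hk => ?_
    have hk' : k ≠ i := (Finset.mem_erase.1 hk).1
    rcases lt_or_gt_of_ne hk' with hlt | hlt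
    · have e : i.castSucc.succAbove k = k.castSucc := Fin.succAbove_of_castSucc_lt _ _ (by simpa using hlt)
      rw [e]
      have := hm hlt
      have := (h k).1
      apply div_pos <;> linarith
    · have e : i.castSucc.succAbove k = k.succ := Fin.succAbove_of_le_castSucc _ _ (by simpa using hlt.le)
      rw [e]
      have := hm hlt
      have := (h k).2
      apply div_pos_of_neg_of_neg <;> linarith

/-- bordered characteristic polynomial -/
noncomputable def polyP {N : ℕ} {R : Type*} [CommRing R] (m : Fin N → R) (r : Fin N → R) (x : R) : R[X] :=
  (X - C x) * ∏ k, (X - C (m k)) - ∑ i, C (r i) * ∏ k ∈ Finset.univ.erase i, (X - C (m k))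

theorem polyP_aux_deg {N : ℕ} (m r : Fin N → ℝ) :
    (∑ i, C (r i) * ∏ k ∈ Finset.univ.erase i, (X - C (m k))).degree < (N : ℕ) := by
  refine (Polynomial.degree_sum_le _ _).trans_lt ?_
  rw [Finset.sup_lt_iff (by exact WithBot.bot_lt_coe _)]
  intro i _
  refine (Polynomial.degree_mul_le _ _).trans_lt
    ((add_le_add Polynomial.degree_C_le le_rfl).trans_lt ?_)
  rw [zero_add, Polynomial.degree_prod]
  simp only [degree_X_sub_C, Finset.sum_const, Finset.card_erase_of_mem (Finset.mem_univ i),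
    Finset.card_univ, Fintype.card_fin, nsmul_eq_mul, mul_one]
  have := i.pos
  exact_mod_cast Nat.sub_lt this one_pos

theorem polyP_snoc {N : ℕ} (m : Fin N → ℝ) (x : ℝ) :
    (X - C x) * ∏ k, (X - C (m k)) = ∏ k : Fin (N+1), (X - C (Fin.snoc (α := fun _ => ℝ) m x k)) := by
  rw [Fin.prod_univ_castSucc]; simp [mul_comm]

theorem coeff_prod_aux {N : ℕ} (l : Fin (N+1) → ℝ) :
    (∏ k, (X - C (l k))).coeff N = -∑ k, l k := by
  have := Polynomial.prod_X_sub_C_coeff_card_pred (Finset.univ) l (by simp)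
  simpa using this

theorem polyP_coeff {N : ℕ} (m r : Fin N → ℝ) (x : ℝ) :
    (polyP m r x).coeff N = - (∑ k, m k + x) := by
  rw [polyP, Polynomial.coeff_sub, Polynomial.coeff_eq_zero_of_degree_lt (polyP_aux_deg m r),
    polyP_snoc, coeff_prod_aux, Fin.sum_univ_castSucc]
  simp

theorem polyP_eval {N : ℕ} (m r : Fin N → ℝ) (x : ℝ) (i : Fin N) :
    (polyP m r x).eval (m i) = - (r i * ∏ k ∈ Finset.univ.erase i, (m i - m k)) := by
  rw [polyP, eval_sub, eval_mul, eval_prod, eval_finsetSum]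
  rw [Finset.prod_eq_zero (Finset.mem_univ i) (by simp), Finset.sum_eq_single i]
  · simp [eval_prod]
  · intro j _ hj
    rw [eval_mul, eval_prod, Finset.prod_eq_zero (i := i) (by simp [hj.symm]) (by simp)]; simp
  · simp

theorem polyP_monic {N : ℕ} (m r : Fin N → ℝ) (x : ℝ) :
    (polyP m r x).Monic ∧ (polyP m r x).natDegree = N + 1 := by
  have h1 : (∏ k : Fin (N+1), (X - C (Fin.snoc (α := fun _ => ℝ) m x k))).Monic :=
    monic_prod_of_monic _ _ fun k _ => monic_X_sub_C _
  have h2 : (∏ k : Fin (N+1), (X - C (Fin.snoc (α := fun _ => ℝ) m x k))).degree = ((N+1 : ℕ) : WithBot ℕ) := by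
    simp [degree_prod]
  have h3 : (∑ i, C (r i) * ∏ k ∈ Finset.univ.erase i, (X - C (m k))).degree
    < (∏ k : Fin (N+1), (X - C (Fin.snoc (α := fun _ => ℝ) m x k))).degree := by
    rw [h2]
    exact (polyP_aux_deg m r).trans (by exact_mod_cast Nat.lt_succ_self N)
  rw [polyP, polyP_snoc]
  refine ⟨h1.sub_of_left h3, ?_⟩
  apply natDegree_eq_of_degree_eq_some
  rw [degree_sub_eq_left_of_degree_lt h3, h2]

theorem Dne {N : ℕ} {m : Fin N → ℝ} (hm : Function.Injective m) (i : Fin N) :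
    ∏ k ∈ Finset.univ.erase i, (m i - m k) ≠ 0 :=
  Finset.prod_ne_zero_iff.2 fun k hk => sub_ne_zero.2 fun h => (Finset.mem_erase.1 hk).1 (hm h).symm

theorem polyP_of_Tmap {N : ℕ} {m : Fin N → ℝ} (hm : Function.Injective m) (l : Fin (N+1) → ℝ)
    (r : Fin N → ℝ) (x : ℝ) (h : Tmap m l = Fin.snoc (α := fun _ => ℝ) r x) :
    polyP m r x = ∏ k, (X - C (l k)) := by
  have hx : ∑ k, l k - ∑ k, m k = x := by
    have := congrFun h (Fin.last N); simpa [Tmap] using this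
  have hr : ∀ i, -(∏ k, (m i - l k)) / ∏ k ∈ Finset.univ.erase i, (m i - m k) = r i := by
    intro i
    have := congrFun h i.castSucc; simpa [Tmap] using this
  have hmon : (∏ k, (X - C (l k))).Monic := monic_prod_of_monic _ _ fun k _ => monic_X_sub_C _
  have hdeg : (∏ k, (X - C (l k))).natDegree = N + 1 := by
    rw [natDegree_prod_of_monic _ _ fun k _ => monic_X_sub_C _]; simp
  rw [← sub_eq_zero]
  refine Polynomial.eq_zero_of_degree_lt_of_eval_index_eq_zero (v := m) (s := Finset.univ) hm.injOn ?_ ?_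
  · simp only [Finset.card_univ, Fintype.card_fin]
    rw [degree_lt_iff_coeff_zero]
    intro k hk
    rw [coeff_sub]
    rcases hk.eq_or_lt with rfl | hk
    · rw [polyP_coeff, coeff_prod_aux, ← hx]; ring
    · rcases (Nat.succ_le_of_lt hk).eq_or_lt with rfl | hk
      · have a1 := (polyP_monic m r x).1.coeff_natDegree
        have a2 := hmon.coeff_natDegree
        rw [(polyP_monic m r x).2] at a1
        rw [hdeg] at a2
        simp [a1, a2]
      · rw [coeff_eq_zero_of_natDegree_lt, coeff_eq_zero_of_natDegree_lt, sub_zero]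
        · rw [hdeg]; exact hk
        · rw [(polyP_monic m r x).2]; exact hk
  · intro i _
    rw [eval_sub, polyP_eval, ← hr i, div_mul_cancel₀ _ (Dne hm i)]
    simp [eval_prod]

theorem Tmap_of_polyP {N : ℕ} {m : Fin N → ℝ} (hm : Function.Injective m) (l : Fin (N+1) → ℝ)
    (r : Fin N → ℝ) (x : ℝ) (h : polyP m r x = ∏ k, (X - C (l k))) :
    Tmap m l = Fin.snoc (α := fun _ => ℝ) r x := by
  ext i
  induction i using Fin.lastCases with
  | last =>
    have := congrArg (fun p => p.coeff N) h
    simp only [polyP_coeff, coeff_prod_aux] at this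
    simp [Tmap]; linarith
  | cast i =>
    have := congrArg (fun p => p.eval (m i)) h
    simp only [polyP_eval, eval_prod, eval_sub, eval_X, eval_C] at this
    simp only [Tmap, Fin.snoc_castSucc]
    rw [← this, neg_neg, mul_div_cancel_right₀ _ (Dne hm i)]

theorem Tmap_injOn {N : ℕ} {m : Fin N → ℝ} (hm : Function.Injective m) :
    Set.InjOn (Tmap m) {l | IL m l} := by
  intro l hl l' hl' h
  have e : Tmap m l = Fin.snoc (α := fun _ => ℝ) (Fin.init (α := fun _ => ℝ) (Tmap m l)) (Tmap m l (Fin.last N)) :=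
    (Fin.snoc_init_self _).symm
  have h1 := polyP_of_Tmap hm l _ _ e
  have h2 := polyP_of_Tmap hm l' _ _ (h.symm.trans e)
  rw [h1] at h2
  have hl0 : StrictMono l := IL.strictMono hl
  have hl0' : StrictMono l' := IL.strictMono hl'
  rw [← hl0.range_inj hl0']
  ext y
  have := congrArg (fun p => p.eval y = 0) h2
  simp only [eval_prod, eval_sub, eval_X, eval_C, Finset.prod_eq_zero_iff, Finset.mem_univ, true_and, sub_eq_zero] at this
  simp only [Set.mem_range]
  simpa only [eq_comm] using this.to_iff

end

section
open Filter Topology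
noncomputable def Rfun {N : ℕ} (m r : Fin N → ℝ) (x t : ℝ) : ℝ := t - x - ∑ k, r k / (t - m k)

theorem Rfun_cont {N : ℕ} (m r : Fin N → ℝ) (x t : ℝ) (h : ∀ k, t ≠ m k) :
    ContinuousAt (Rfun m r x) t := by
  unfold Rfun
  refine ContinuousAt.sub (by fun_prop) ?_
  refine tendsto_finsetSum _ fun k _ => ?_
  exact ContinuousAt.div (by fun_prop) (by fun_prop) (sub_ne_zero.2 (h k))

theorem Rfun_split {N : ℕ} (m r : Fin N → ℝ) (x t : ℝ) (i : Fin N) :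
    Rfun m r x t = (t - x - ∑ k ∈ Finset.univ.erase i, r k / (t - m k)) + r i * (-(t - m i)⁻¹) := by
  rw [Rfun, ← Finset.add_sum_erase _ _ (Finset.mem_univ i)]; ring

theorem Rfun_cont' {N : ℕ} (m r : Fin N → ℝ) (hm : Function.Injective m) (x : ℝ) (i : Fin N) :
    ContinuousAt (fun t => (t - x - ∑ k ∈ Finset.univ.erase i, r k / (t - m k))) (m i) := by
  refine ContinuousAt.sub (by fun_prop) ?_
  refine tendsto_finsetSum _ fun k hk => ?_
  exact ContinuousAt.div (by fun_prop) (by fun_prop)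
    (sub_ne_zero.2 fun h => (Finset.mem_erase.1 hk).1 (hm h).symm)

theorem Rfun_right {N : ℕ} (m r : Fin N → ℝ) (hm : Function.Injective m) (hr : ∀ i, 0 < r i) (x : ℝ)
    (i : Fin N) : Tendsto (Rfun m r x) (𝓝[>] (m i)) atBot := by
  rw [show Rfun m r x = _ from funext fun t => Rfun_split m r x t i]
  refine Tendsto.add_atBot ((Rfun_cont' m r hm x i).tendsto.mono_left nhdsWithin_le_nhds) ?_
  refine Tendsto.const_mul_atBot (hr i) ?_
  rw [tendsto_neg_atBot_iff]
  refine tendsto_inv_nhdsGT_zero.comp ?_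
  refine tendsto_nhdsWithin_iff.2 ⟨?_, ?_⟩
  · refine Tendsto.mono_left ?_ nhdsWithin_le_nhds
    have : ContinuousAt (fun t : ℝ => t - m i) (m i) := by fun_prop
    simpa [ContinuousAt] using this
  · filter_upwards [self_mem_nhdsWithin] with t ht
    simpa using ht

theorem Rfun_left {N : ℕ} (m r : Fin N → ℝ) (hm : Function.Injective m) (hr : ∀ i, 0 < r i) (x : ℝ)
    (i : Fin N) : Tendsto (Rfun m r x) (𝓝[<] (m i)) atTop := by
  rw [show Rfun m r x = _ from funext fun t => Rfun_split m r x t i]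
  refine Tendsto.add_atTop ((Rfun_cont' m r hm x i).tendsto.mono_left nhdsWithin_le_nhds) ?_
  refine Tendsto.const_mul_atTop (hr i) ?_
  rw [tendsto_neg_atTop_iff]
  refine tendsto_inv_nhdsLT_zero.comp ?_
  refine tendsto_nhdsWithin_iff.2 ⟨?_, ?_⟩
  · refine Tendsto.mono_left ?_ nhdsWithin_le_nhds
    have : ContinuousAt (fun t : ℝ => t - m i) (m i) := by fun_prop
    simpa [ContinuousAt] using this
  · filter_upwards [self_mem_nhdsWithin] with t ht
    simpa using ht

theorem Rfun_sum_top {N : ℕ} (m r : Fin N → ℝ) :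
    Tendsto (fun t => -∑ k, r k / (t - m k)) atTop (𝓝 0) := by
  rw [show (0:ℝ) = -∑ k : Fin N, (0:ℝ) by simp]
  refine Tendsto.neg (tendsto_finsetSum _ fun k _ => ?_)
  refine Tendsto.const_div_atTop ?_ _
  simpa [sub_eq_add_neg] using tendsto_atTop_add_const_right atTop (-m k) tendsto_id

theorem Rfun_sum_bot {N : ℕ} (m r : Fin N → ℝ) :
    Tendsto (fun t => -∑ k, r k / (t - m k)) atBot (𝓝 0) := by
  rw [show (0:ℝ) = -∑ k : Fin N, (0:ℝ) by simp]
  refine Tendsto.neg (tendsto_finsetSum _ fun k _ => ?_)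
  refine Tendsto.const_div_atBot ?_ _
  simpa [sub_eq_add_neg] using tendsto_atBot_add_const_right atBot (-m k) tendsto_id

theorem Rfun_top {N : ℕ} (m r : Fin N → ℝ) (x : ℝ) : Tendsto (Rfun m r x) atTop atTop := by
  have : Rfun m r x = fun t => (t + -x) + -∑ k, r k / (t - m k) := by ext t; simp [Rfun, sub_eq_add_neg]
  rw [this]
  exact Tendsto.atTop_add (tendsto_atTop_add_const_right atTop (-x) tendsto_id) (Rfun_sum_top m r)

theorem Rfun_bot {N : ℕ} (m r : Fin N → ℝ) (x : ℝ) : Tendsto (Rfun m r x) atBot atBot := by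
  have : Rfun m r x = fun t => (t + -x) + -∑ k, r k / (t - m k) := by ext t; simp [Rfun, sub_eq_add_neg]
  rw [this]
  exact Tendsto.atBot_add (tendsto_atBot_add_const_right atBot (-x) tendsto_id) (Rfun_sum_bot m r)

theorem gap_root {N : ℕ} (m r : Fin N → ℝ) (hm : StrictMono m) (hr : ∀ i, 0 < r i) (x : ℝ)
    (j : Fin (N+1)) : ∃ t, (∀ k : Fin N, k.castSucc < j → m k < t) ∧
      (∀ k : Fin N, j ≤ k.castSucc → t < m k) ∧ Rfun m r x t = 0 := by
  obtain ⟨p, hp1, hp2⟩ : ∃ p, (∀ k : Fin N, k.castSucc < j → m k < p) ∧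
      (∀ k : Fin N, j ≤ k.castSucc → p < m k) := by
    obtain ⟨p, h1, h2⟩ := Order.exists_between_finsets
      (lo := (Finset.univ.filter fun k : Fin N => k.castSucc < j).image m)
      (hi := (Finset.univ.filter fun k : Fin N => j ≤ k.castSucc).image m) (by
        simp only [Finset.mem_image, Finset.mem_filter, Finset.mem_univ, true_and]
        rintro _ ⟨k, hk, rfl⟩ _ ⟨k', hk', rfl⟩
        exact hm (by simpa using hk.trans_le hk'))
    refine ⟨p, fun k hk => h1 _ ?_, fun k hk => h2 _ ?_⟩
    · simp only [Finset.mem_image, Finset.mem_filter, Finset.mem_univ, true_and]; exact ⟨k, hk, rfl⟩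
    · simp only [Finset.mem_image, Finset.mem_filter, Finset.mem_univ, true_and]; exact ⟨k, hk, rfl⟩
  obtain ⟨a, ha1, ha2, ha3⟩ : ∃ a, a ≤ p ∧ (∀ k : Fin N, k.castSucc < j → m k < a) ∧ Rfun m r x a < 0 := by
    induction j using Fin.cases with
    | zero =>
      obtain ⟨a, h1, h2⟩ := ((Rfun_bot m r x).eventually (eventually_lt_atBot 0) |>.and (eventually_le_atBot p)).exists
      exact ⟨a, h2, fun k hk => absurd hk (by simp), h1⟩
    | succ i =>
      have hip : m i < p := hp1 i (Fin.castSucc_lt_succ)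
      obtain ⟨a, ⟨h1, h2⟩, h3⟩ := ((Rfun_right m r hm.injective hr x i).eventually (eventually_lt_atBot 0)
        |>.and (Ioo_mem_nhdsGT hip)).and self_mem_nhdsWithin |>.exists
      refine ⟨a, h2.2.le, fun k hk => (hm.monotone ?_).trans_lt h2.1, h1⟩
      rw [Fin.lt_def] at hk; rw [Fin.le_def]; simp at hk; omega
  obtain ⟨b, hb1, hb2, hb3⟩ : ∃ b, p ≤ b ∧ (∀ k : Fin N, j ≤ k.castSucc → b < m k) ∧ 0 < Rfun m r x b := by
    induction j using Fin.lastCases with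
    | last =>
      obtain ⟨a, h1, h2⟩ := ((Rfun_top m r x).eventually (eventually_gt_atTop 0) |>.and (eventually_ge_atTop p)).exists
      exact ⟨a, h2, fun k hk => absurd hk (not_le_of_gt (Fin.castSucc_lt_last k)), h1⟩
    | cast i =>
      have hip : p < m i := hp2 i le_rfl
      obtain ⟨a, ⟨h1, h2⟩, h3⟩ := ((Rfun_left m r hm.injective hr x i).eventually (eventually_gt_atTop 0)
        |>.and (Ioo_mem_nhdsLT hip)).and self_mem_nhdsWithin |>.exists
      exact ⟨a, h2.1.le, fun k hk => h2.2.trans_le (hm.monotone (by simpa using hk)), h1⟩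
  have hc : ContinuousOn (Rfun m r x) (Set.Icc a b) := by
    intro t ht
    refine (Rfun_cont m r x t fun k => ?_).continuousWithinAt
    rcases lt_or_ge k.castSucc j with h | h
    · exact ((ha2 k h).trans_le ht.1).ne'
    · exact (ht.2.trans_lt (hb2 k h)).ne
  obtain ⟨t, ht, h0⟩ := intermediate_value_Icc (ha1.trans hb1) hc ⟨ha3.le, hb3.le⟩
  exact ⟨t, fun k hk => (ha2 k hk).trans_le ht.1, fun k hk => ht.2.trans_lt (hb2 k hk), h0⟩

theorem Tmap_surj {N : ℕ} (m r : Fin N → ℝ) (hm : StrictMono m) (hr : ∀ i, 0 < r i) (x : ℝ) :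
    ∃ l, IL m l ∧ Tmap m l = Fin.snoc (α := fun _ => ℝ) r x := by
  choose l h1 h2 h3 using gap_root m r hm hr x
  have hIL : IL m l := fun i => ⟨h2 _ i le_rfl, h1 _ i Fin.castSucc_lt_succ⟩
  refine ⟨l, hIL, Tmap_of_polyP hm.injective l r x ?_⟩
  have hmon : (∏ k, (X - C (l k))).Monic := monic_prod_of_monic _ _ fun k _ => monic_X_sub_C _
  have hdeg : (∏ k, (X - C (l k))).natDegree = N + 1 := by
    rw [natDegree_prod_of_monic _ _ fun k _ => monic_X_sub_C _]; simp
  obtain ⟨pm, pd⟩ := polyP_monic m r x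
  refine eq_of_degree_sub_lt_of_eval_index_eq (v := l) Finset.univ hIL.strictMono.injective.injOn ?_ ?_
  · have : (polyP m r x).degree = ((N+1 : ℕ) : WithBot ℕ) := by
      rw [degree_eq_natDegree pm.ne_zero, pd]
    simp only [Finset.card_univ, Fintype.card_fin]
    rw [← this]
    refine degree_sub_lt_left ?_ pm.ne_zero ?_
    · rw [this, degree_eq_natDegree hmon.ne_zero, hdeg]
    · rw [pm.leadingCoeff, hmon.leadingCoeff]
  · intro j _
    have hne : ∀ k, l j - m k ≠ 0 := by
      intro k
      rcases lt_or_ge k.castSucc j with h | h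
      · exact sub_ne_zero.2 (h1 j k h).ne'
      · exact sub_ne_zero.2 (h2 j k h).ne
    have e : (polyP m r x).eval (l j) = (∏ k, (l j - m k)) * Rfun m r x (l j) := by
      rw [polyP, Rfun]
      simp only [eval_sub, eval_mul, eval_X, eval_C, eval_prod, eval_finsetSum]
      rw [mul_sub, Finset.mul_sum, mul_comm]
      congr 1
      refine Finset.sum_congr rfl fun i _ => ?_
      rw [← Finset.mul_prod_erase _ _ (Finset.mem_univ i)]
      have := hne i
      field_simp
    rw [e, h3, mul_zero, eval_prod, Finset.prod_eq_zero (Finset.mem_univ j) (by simp)]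

theorem Tmap_image {N : ℕ} (m : Fin N → ℝ) (hm : StrictMono m) :
    Tmap m '' {l | IL m l} = {y | ∀ i : Fin N, 0 < y i.castSucc} := by
  ext y; constructor
  · rintro ⟨l, hl, rfl⟩ i
    exact Tmap_pos hl i
  · intro hy
    obtain ⟨l, h1, h2⟩ := Tmap_surj m (Fin.init (α := fun _ => ℝ) y) hm hy (y (Fin.last N))
    exact ⟨l, h1, h2.trans (Fin.snoc_init_self _)⟩

end

section
open Filter Topology
noncomputable def VD {N : ℕ} (x : Fin N → ℝ) : ℝ := (Matrix.vandermonde x).det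

theorem VD_pos {N : ℕ} {x : Fin N → ℝ} (hx : StrictMono x) : 0 < VD x := by
  rw [VD, det_vandermonde]
  refine Finset.prod_pos fun i _ => Finset.prod_pos fun j hj => ?_
  exact sub_pos.2 (hx (Finset.mem_Ioi.1 hj))

theorem VD_cont {N : ℕ} : Continuous (VD (N := N)) := by
  unfold VD
  simp only [det_vandermonde]
  fun_prop

theorem VD_dbl {N : ℕ} (x : Fin N → ℝ) :
    |∏ i, ∏ k ∈ Finset.univ.erase i, (x i - x k)| = VD x ^ 2 := by
  have h1 : ∀ i : Fin N, ∏ k ∈ Finset.univ.erase i, |x i - x k| =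
      (∏ k ∈ Finset.Iio i, |x i - x k|) * ∏ k ∈ Finset.Ioi i, |x i - x k| := by
    intro i
    rw [← Finset.prod_union]
    · congr 1; ext k; simp [lt_or_lt_iff_ne]
    · rw [Finset.disjoint_left]; intro k h1 h2
      simp at h1 h2; exact absurd h1 (not_lt_of_gt h2)
  have h2 : ∏ i, ∏ k ∈ Finset.Iio i, |x i - x k| = ∏ i, ∏ k ∈ Finset.Ioi i, |x k - x i| := by
    refine Finset.prod_comm' ?_
    intro i k; simp
  have h3 : ∏ i, ∏ k ∈ Finset.Ioi i, |x k - x i| = |VD x| := by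
    rw [VD, det_vandermonde, Finset.abs_prod]
    refine Finset.prod_congr rfl fun i _ => ?_
    rw [Finset.abs_prod]
  rw [Finset.abs_prod]
  simp only [Finset.abs_prod, h1, Finset.prod_mul_distrib]
  rw [h2]
  have : ∏ i, ∏ k ∈ Finset.Ioi i, |x i - x k| = ∏ i, ∏ k ∈ Finset.Ioi i, |x k - x i| := by
    simp only [abs_sub_comm]
  rw [this, h3, ← sq, sq_abs]

noncomputable def Bmat {N : ℕ} (m : Fin N → ℝ) (l : Fin (N+1) → ℝ) : Matrix (Fin (N+1)) (Fin (N+1)) ℝ :=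
  Matrix.of fun i j => Fin.snoc (α := fun _ => ℝ) (fun i => ∏ k ∈ Finset.univ.erase j, (m i - l k)) 1 i

theorem natDegree_q {N : ℕ} (l : Fin (N+1) → ℝ) (j : Fin (N+1)) :
    (∏ k ∈ Finset.univ.erase j, (X - C (l k))).natDegree = N := by
  rw [natDegree_prod_of_monic _ _ fun k _ => monic_X_sub_C _]; simp

theorem Bmat_det {N : ℕ} (m : Fin N → ℝ) (l : Fin (N+1) → ℝ) (hl : VD l ≠ 0) :
    |(Bmat m l).det| = |VD m| * |VD l| := by
  set Q : Matrix (Fin (N+1)) (Fin (N+1)) ℝ :=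
    Matrix.of fun a j => (∏ k ∈ Finset.univ.erase j, (X - C (l k))).coeff (a : ℕ)
  set W : Matrix (Fin (N+1)) (Fin (N+1)) ℝ :=
    Matrix.of fun i a => Fin.snoc (α := fun _ => ℝ) (fun i => m i ^ (a : ℕ)) (if a = Fin.last N then 1 else 0) i
  have ev : ∀ (t : ℝ) (j : Fin (N+1)), ∑ a : Fin (N+1), t ^ (a : ℕ) * Q a j = ∏ k ∈ Finset.univ.erase j, (t - l k) := by
    intro t j
    have := eval_eq_sum_range' (p := ∏ k ∈ Finset.univ.erase j, (X - C (l k))) (n := N+1) (by rw [natDegree_q]; omega) t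
    rw [eval_prod] at this
    simp only [eval_sub, eval_X, eval_C] at this
    rw [this, Finset.sum_range]
    refine Finset.sum_congr rfl fun a _ => ?_
    simp [Q, mul_comm]
  have hB : Bmat m l = W * Q := by
    ext i j
    rw [Matrix.mul_apply]
    induction i using Fin.lastCases with
    | last =>
      simp only [Bmat, W, Matrix.of_apply, Fin.snoc_last, ite_mul, one_mul, zero_mul, Finset.sum_ite_eq', Finset.mem_univ, if_true]
      simp only [Q, Matrix.of_apply, Fin.val_last]
      have h := (monic_prod_of_monic (Finset.univ.erase j) (fun k => X - C (l k)) fun k _ => monic_X_sub_C _).coeff_natDegree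
      rw [natDegree_q] at h
      exact h.symm
    | cast i =>
      simp only [Bmat, W, Matrix.of_apply, Fin.snoc_castSucc]
      rw [ev]
  have hV : Matrix.vandermonde l * Q = Matrix.diagonal fun j => ∏ k ∈ Finset.univ.erase j, (l j - l k) := by
    ext i j
    rw [Matrix.mul_apply]
    simp only [Matrix.vandermonde_apply]
    rw [ev, Matrix.diagonal_apply]
    split_ifs with h
    · rw [h]
    · exact Finset.prod_eq_zero (i := i) (by simp [h]) (by simp)
  have hW : W.det = VD m := by
    rw [Matrix.det_succ_row W (Fin.last N), Finset.sum_eq_single (Fin.last N)]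
    · simp only [Fin.succAbove_last]
      have : W (Fin.last N) (Fin.last N) = 1 := by simp [W]
      rw [this]
      have h2 : W.submatrix Fin.castSucc Fin.castSucc = Matrix.vandermonde m := by
        ext i j; simp [W, Matrix.vandermonde_apply]
      rw [h2, VD]
      simp [← two_mul, pow_mul]
    · intro j _ hj
      simp [W, hj]
    · simp
  have hdet := congrArg Matrix.det hV
  rw [Matrix.det_mul, Matrix.det_diagonal] at hdet
  have h3 := VD_dbl l
  rw [← hdet, abs_mul] at h3
  have h4 : |Q.det| = |VD l| := by
    have h0 : |VD l| ≠ 0 := abs_ne_zero.2 hl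
    rw [← sq_abs (VD l), sq] at h3
    exact mul_left_cancel₀ h0 h3
  rw [hB, Matrix.det_mul, abs_mul, h4, hW]

noncomputable def Jmat {N : ℕ} (m : Fin N → ℝ) (l : Fin (N+1) → ℝ) : Matrix (Fin (N+1)) (Fin (N+1)) ℝ :=
  Matrix.diagonal (Fin.snoc (α := fun _ => ℝ) (fun i => (∏ k ∈ Finset.univ.erase i, (m i - m k))⁻¹) 1) * Bmat m l

theorem Jmat_det {N : ℕ} (m : Fin N → ℝ) (l : Fin (N+1) → ℝ) (hm : StrictMono m) (hl : StrictMono l) :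
    |(Jmat m l).det| = VD l / VD m := by
  have h1 := VD_pos hm
  have h2 := VD_pos hl
  rw [Jmat, Matrix.det_mul, abs_mul, Bmat_det m l h2.ne', Matrix.det_diagonal, Fin.prod_univ_castSucc]
  simp only [Fin.snoc_castSucc, Fin.snoc_last, mul_one]
  rw [Finset.prod_inv_distrib, abs_inv, VD_dbl, abs_of_pos h1, abs_of_pos h2]
  field_simp

theorem Tmap_hasFDerivAt {N : ℕ} (m : Fin N → ℝ) (l : Fin (N+1) → ℝ) :
    HasFDerivAt (Tmap m) (Matrix.toLin' (Jmat m l)).toContinuousLinearMap l := by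
  rw [hasFDerivAt_pi']
  intro i
  induction i using Fin.lastCases with
  | last =>
    have h : HasFDerivAt (fun l : Fin (N+1) → ℝ => ∑ k, l k - ∑ k, m k)
      (∑ k : Fin (N+1), ContinuousLinearMap.proj (R := ℝ) (φ := fun _ => ℝ) k) l := by
      refine HasFDerivAt.sub_const _ ?_
      exact HasFDerivAt.fun_sum fun k _ => hasFDerivAt_apply k l
    have e : (fun x => Tmap m x (Fin.last N)) = (fun l : Fin (N+1) → ℝ => ∑ k, l k - ∑ k, m k) := by
      ext x; simp [Tmap]
    rw [e]
    refine h.congr_fderiv ?_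
    refine ContinuousLinearMap.ext fun v => ?_
    simp [Jmat, Bmat, Matrix.mulVec, dotProduct, Matrix.diagonal_mul]
  | cast i =>
    have h : HasFDerivAt (fun l : Fin (N+1) → ℝ => -(∏ k, (m i - l k)) / ∏ k ∈ Finset.univ.erase i, (m i - m k))
      ((∏ k ∈ Finset.univ.erase i, (m i - m k))⁻¹ • -(∑ j, (∏ k ∈ Finset.univ.erase j, (m i - l k)) •
        -(ContinuousLinearMap.proj (R := ℝ) (φ := fun _ : Fin (N+1) => ℝ) j))) l := by
      simp only [div_eq_inv_mul]
      refine HasFDerivAt.const_mul ?_ _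
      refine HasFDerivAt.neg ?_
      refine HasFDerivAt.finsetProd fun k _ => ?_
      exact (hasFDerivAt_apply k l).const_sub _
    have e : (fun x => Tmap m x i.castSucc) = (fun l : Fin (N+1) → ℝ => -(∏ k, (m i - l k)) / ∏ k ∈ Finset.univ.erase i, (m i - m k)) := by
      ext x; simp [Tmap]
    rw [e]
    refine h.congr_fderiv ?_
    refine ContinuousLinearMap.ext fun v => ?_
    simp [Jmat, Bmat, Matrix.mulVec, dotProduct, Matrix.diagonal_mul, Finset.mul_sum, mul_assoc]

theorem measurableSet_IL {N : ℕ} (m : Fin N → ℝ) : MeasurableSet {l | IL m l} := by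
  unfold IL
  simp only [Set.ofPred_forall, Set.ofPred_and]
  refine MeasurableSet.iInter fun i => MeasurableSet.inter ?_ ?_
  · exact measurableSet_lt (by fun_prop) (by fun_prop)
  · exact measurableSet_lt (by fun_prop) (by fun_prop)

theorem cv {N : ℕ} (m : Fin N → ℝ) (hm : StrictMono m) (G : (Fin (N+1) → ℝ) → ENNReal) (hG : Measurable G) :
    ∫⁻ r in Set.univ.pi (fun _ : Fin N => Set.Ioi (0:ℝ)), ∫⁻ x : ℝ, G (Fin.snoc (α := fun _ => ℝ) r x) =
    ∫⁻ l in {l | IL m l}, ENNReal.ofReal (VD l / VD m) * G (Tmap m l) := by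
  have h := lintegral_image_eq_lintegral_abs_det_fderiv_mul (volume : Measure (Fin (N+1) → ℝ)) (measurableSet_IL m)
    (fun l _ => (Tmap_hasFDerivAt m l).hasFDerivWithinAt) (Tmap_injOn hm.injective) G
  rw [Tmap_image m hm] at h
  have hS : MeasurableSet {y : Fin (N+1) → ℝ | ∀ i : Fin N, 0 < y i.castSucc} := by
    simp only [Set.ofPred_forall]
    exact MeasurableSet.iInter fun i => measurableSet_lt (by fun_prop) (by fun_prop)
  have h2 : ∫⁻ y in {y : Fin (N+1) → ℝ | ∀ i : Fin N, 0 < y i.castSucc}, G y =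
      ∫⁻ r in Set.univ.pi (fun _ : Fin N => Set.Ioi (0:ℝ)), ∫⁻ x : ℝ, G (Fin.snoc (α := fun _ => ℝ) r x) := by
    rw [← lintegral_indicator hS, lintegral_snoc _ (hG.indicator hS),
      ← lintegral_indicator (MeasurableSet.univ_pi fun _ => measurableSet_Ioi)]
    refine lintegral_congr fun d => ?_
    by_cases hd : d ∈ Set.univ.pi (fun _ : Fin N => Set.Ioi (0:ℝ))
    · rw [Set.indicator_of_mem hd]
      refine lintegral_congr fun x => ?_
      rw [Set.indicator_of_mem]
      intro i; simpa using hd i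
    · rw [Set.indicator_of_notMem hd]
      rw [← lintegral_zero (μ := (volume : Measure ℝ))]
      refine lintegral_congr fun x => ?_
      rw [Set.indicator_of_notMem]
      intro hh; apply hd; intro i _; simpa using hh i
  rw [← h2, h]
  refine setLIntegral_congr_fun (measurableSet_IL m) fun l hl => ?_
  have hl' : IL m l := hl
  have : ((Matrix.toLin' (Jmat m l)).toContinuousLinearMap).det = (Jmat m l).det := by
    rw [ContinuousLinearMap.det, LinearMap.coe_toContinuousLinearMap, LinearMap.det_toLin']
  simp only [this]
  rw [Jmat_det m l hm hl'.strictMono]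

end

section
open Filter Topology
theorem border_diag_charpoly {N : ℕ} (m : Fin N → ℝ) (v : Fin N → ℂ) (x : ℝ) :
    (border (Matrix.diagonal fun i => (m i : ℂ)) v x).charpoly =
      polyP (fun i => (m i : ℂ)) (fun i => ((Complex.normSq (v i) : ℝ) : ℂ)) (x : ℂ) := by
  apply Polynomial.eq_of_infinite_eval_eq
  refine Set.Infinite.mono ?_ (Set.Finite.infinite_compl (Set.finite_range (fun i => (m i : ℂ))))
  intro t ht
  have hne : ∀ i, t - m i ≠ 0 := fun i h => ht ⟨i, (sub_eq_zero.1 h).symm⟩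
  simp only [Set.mem_ofPred_eq]
  unfold border
  rw [Matrix.charpoly_reindex, Matrix.eval_charpoly]
  have e : (Matrix.scalar (Fin N ⊕ Fin 1)) t - Matrix.fromBlocks (Matrix.diagonal fun i => (m i : ℂ))
      (Matrix.of fun i (_ : Fin 1) => v i) (Matrix.of fun _ i => star (v i)) (Matrix.of fun _ _ => (x : ℂ))
      = Matrix.fromBlocks (Matrix.diagonal fun i => t - (m i : ℂ))
      (Matrix.of fun i (_ : Fin 1) => - v i) (Matrix.of fun _ i => - star (v i)) (Matrix.of fun _ _ => t - (x : ℂ)) := by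
    ext i j
    rcases i with i | i <;> rcases j with j | j
    · by_cases h : i = j
      · subst h; simp
      · simp [h]
    · simp
    · simp
    · have : i = j := Subsingleton.elim _ _
      subst this; simp
  rw [e]
  have hinv : (Matrix.diagonal fun i => (t - (m i : ℂ))⁻¹) * (Matrix.diagonal fun i => t - (m i : ℂ)) = 1 := by
    rw [Matrix.diagonal_mul_diagonal]
    simp [hne]
  have hinv2 : (Matrix.diagonal fun i => t - (m i : ℂ)) * (Matrix.diagonal fun i => (t - (m i : ℂ))⁻¹)  = 1 := by
    rw [Matrix.diagonal_mul_diagonal]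
    simp [hne]
  let _ : Invertible (Matrix.diagonal fun i => t - (m i : ℂ)) := ⟨_, hinv, hinv2⟩
  rw [Matrix.det_fromBlocks₁₁, Matrix.det_diagonal]
  have : ⅟(Matrix.diagonal fun i => t - (m i : ℂ)) = (Matrix.diagonal fun i => (t - (m i : ℂ))⁻¹) := rfl
  rw [this]
  simp only [Matrix.det_fin_one, Matrix.sub_apply, Matrix.of_apply, Matrix.mul_apply, Matrix.diagonal_apply]
  simp only [polyP, eval_sub, eval_mul, eval_X, eval_C, eval_prod, eval_finsetSum, mul_ite, mul_zero,
    Finset.sum_ite_eq', Finset.mem_univ, if_true]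
  rw [mul_sub, mul_comm, Finset.mul_sum]
  congr 1
  refine Finset.sum_congr rfl fun i _ => ?_
  rw [← Finset.mul_prod_erase _ _ (Finset.mem_univ i)]
  have := hne i
  have h2 : (Complex.normSq (v i) : ℂ) = star (v i) * v i := Complex.normSq_eq_conj_mul_self
  rw [h2]
  field_simp

theorem border_diag_IL {N : ℕ} (m : Fin N → ℝ) (hm : StrictMono m) (v : Fin N → ℂ) (x : ℝ) (l : Fin (N+1) → ℝ)
    (h : Tmap m l = Fin.snoc (α := fun _ => ℝ) (fun i => Complex.normSq (v i)) x) :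
    (border (Matrix.diagonal fun i => (m i : ℂ)) v x).charpoly = (Matrix.diagonal fun i => (l i : ℂ)).charpoly := by
  have h1 := polyP_of_Tmap hm.injective l _ _ h
  rw [border_diag_charpoly, Matrix.charpoly_diagonal]
  have h2 := congrArg (Polynomial.map (algebraMap ℝ ℂ)) h1
  simpa [polyP, Polynomial.map_prod, Polynomial.map_sum] using h2

theorem hermOf_diag_s11 {N : ℕ} (m : Fin N → ℝ) :
    hermOf (m, 0) = Matrix.diagonal fun i => (m i : ℂ) := by
  ext i j
  rcases lt_trichotomy i j with h | h | h
  · simp [hermOf, h, h.ne]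
  · subst h; simp [hermOf]
  · simp [hermOf, h, h.ne', not_lt_of_gt h]

/-- class functions -/
def ClassFn {N : ℕ} (f : Matrix (Fin N) (Fin N) ℂ → ENNReal) : Prop :=
  (Measurable fun c : HCoords N => f (hermOf c)) ∧
  ∀ A B : Matrix (Fin N) (Fin N) ℂ, A.IsHermitian → B.IsHermitian → A.charpoly = B.charpoly → f A = f B

noncomputable def gfun {N : ℕ} (f : Matrix (Fin (N+1)) (Fin (N+1)) ℂ → ENNReal) (s : ℝ)
    (A : Matrix (Fin N) (Fin N) ℂ) : ENNReal :=
  ∫⁻ x : ℝ, ∫⁻ v : Fin N → ℂ, f (border A v x) * ENNReal.ofReal (Real.exp (s * x))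

theorem diag_herm {N : ℕ} (m : Fin N → ℝ) :
    (Matrix.diagonal fun i => (m i : ℂ)).IsHermitian := by
  rw [← hermOf_diag_s11]; exact hermOf_isHermitian _

theorem herm_exists {N : ℕ} {A : Matrix (Fin N) (Fin N) ℂ} (hA : A.IsHermitian) :
    ∃ c, A = hermOf c := by
  refine ⟨(fun i => (A i i).re, fun p => A p.1.1 p.1.2), ?_⟩
  ext i j
  rcases lt_trichotomy i j with h | h | h
  · simp [hermOf, h]
  · subst h; simp only [hermOf, Matrix.of_apply, lt_irrefl, dite_false]
    exact (Complex.conj_eq_iff_re.1 (hA.apply i i)).symm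
  · simp only [hermOf, Matrix.of_apply, h, not_lt_of_gt h, dite_false, dite_true]
    exact (hA.apply i j).symm

theorem ClassFn.meas_border {N : ℕ} {f : Matrix (Fin (N+1)) (Fin (N+1)) ℂ → ENNReal} (hf : ClassFn f)
    (s : ℝ) : Measurable fun q : HCoords N × (ℝ × (Fin N → ℂ)) =>
      f (border (hermOf q.1) q.2.2 q.2.1) * ENNReal.ofReal (Real.exp (s * q.2.1)) := by
  have := hf.1.comp (measurable_joinC (N := N))
  refine Measurable.mul ?_ (by fun_prop)
  convert this using 2 with q
  exact congrArg f (hermOf_joinC q.1 q.2.1 q.2.2).symm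

theorem ClassFn.gfun {N : ℕ} {f : Matrix (Fin (N+1)) (Fin (N+1)) ℂ → ENNReal} (hf : ClassFn f)
    (s : ℝ) : ClassFn (gfun f s) := by
  refine ⟨?_, ?_⟩
  · have h1 : Measurable fun q : (HCoords N × ℝ) × (Fin N → ℂ) =>
      f (border (hermOf q.1.1) q.2 q.1.2) * ENNReal.ofReal (Real.exp (s * q.1.2)) :=
      (hf.meas_border s).comp (g := fun q : HCoords N × (ℝ × (Fin N → ℂ)) => _)
        (f := fun q : (HCoords N × ℝ) × (Fin N → ℂ) => (q.1.1, (q.1.2, q.2))) (by fun_prop)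
    exact Measurable.lintegral_prod_right' (f := fun q : HCoords N × ℝ => ∫⁻ v : Fin N → ℂ, f (border (hermOf q.1) v q.2) * ENNReal.ofReal (Real.exp (s * q.2)))
      (Measurable.lintegral_prod_right' h1)
  · intro A B hA hB h
    obtain ⟨U, h1, h2, rfl⟩ := herm_conj hA hB h
    unfold _root_.gfun
    refine lintegral_congr fun x => ?_
    have e : ∀ v, f (border (U * A * star U) v x) = f (border A (star U *ᵥ v) x) := fun v =>
      hf.2 _ _ (border_isHermitian hB v x) (border_isHermitian hA _ x) (border_charpoly_conj h1 h2 v x)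
    simp only [e]
    symm
    obtain ⟨c, rfl⟩ := herm_exists hA
    refine lintegral_unitary (U := star U) (by rw [star_star]; exact h1)
      (fun v => f (border (hermOf c) v x) * ENNReal.ofReal (Real.exp (s * x))) ?_
    exact (hf.meas_border s).comp (g := fun q : HCoords N × (ℝ × (Fin N → ℂ)) => _)
        (f := fun v : (Fin N → ℂ) => (c, (x, v))) (by fun_prop)

theorem gfun_diag {N : ℕ} {f : Matrix (Fin (N+1)) (Fin (N+1)) ℂ → ENNReal} (hf : ClassFn f)
    (s : ℝ) (m : Fin N → ℝ) (hm : StrictMono m) :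
    gfun f s (Matrix.diagonal fun i => (m i : ℂ)) =
      ENNReal.ofReal Real.pi ^ N * ∫⁻ l in {l | IL m l},
        ENNReal.ofReal (VD l / VD m) * (f (Matrix.diagonal fun i => (l i : ℂ)) *
          ENNReal.ofReal (Real.exp (s * (∑ k, l k - ∑ k, m k)))) := by
  set G : (Fin (N+1) → ℝ) → ENNReal := fun y =>
    f (border (Matrix.diagonal fun i => (m i : ℂ)) (fun i => ((Real.sqrt (y i.castSucc) : ℝ) : ℂ)) (y (Fin.last N)))
      * ENNReal.ofReal (Real.exp (s * y (Fin.last N))) with hGdef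
  have hG : Measurable G := by
    simp only [hGdef, ← hermOf_diag_s11]
    exact (hf.meas_border s).comp (g := fun q : HCoords N × (ℝ × (Fin N → ℂ)) => _)
        (f := fun y : (Fin (N+1) → ℝ) => ((m, 0), (y (Fin.last N), (fun i : Fin N => ((Real.sqrt (y i.castSucc) : ℝ) : ℂ))))) (by fun_prop)
  have hsn : Measurable fun q : ℝ × (Fin N → ℝ) => (Fin.snoc (α := fun _ => ℝ) q.2 q.1 : Fin (N+1) → ℝ) := by
    rw [measurable_pi_iff]
    intro i
    induction i using Fin.lastCases with
    | last => simpa using measurable_fst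
    | cast i => simp only [Fin.snoc_castSucc]; fun_prop
  have h1 : gfun f s (Matrix.diagonal fun i => (m i : ℂ)) =
      ∫⁻ x : ℝ, ENNReal.ofReal Real.pi ^ N * ∫⁻ r in Set.univ.pi (fun _ : Fin N => Set.Ioi (0:ℝ)),
        G (Fin.snoc (α := fun _ => ℝ) r x) := by
    unfold gfun
    refine lintegral_congr fun x => ?_
    rw [← lintegral_normSq (fun r => G (Fin.snoc (α := fun _ => ℝ) r x))
      (hG.comp (hsn.comp (g := fun q : ℝ × (Fin N → ℝ) => _) (f := fun r => (x, r)) (by fun_prop)))]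
    refine lintegral_congr fun v => ?_
    simp only [hGdef, Fin.snoc_castSucc, Fin.snoc_last]
    congr 1
    apply hf.2 _ _ (border_isHermitian (diag_herm m) _ _) (border_isHermitian (diag_herm m) _ _)
    rw [border_diag_charpoly, border_diag_charpoly]
    congr 1
    ext i
    rw [Complex.normSq_ofReal, Real.mul_self_sqrt (Complex.normSq_nonneg _)]
  rw [h1]
  have hGs : Measurable (fun q : ℝ × (Fin N → ℝ) => G (Fin.snoc (α := fun _ => ℝ) q.2 q.1)) := hG.comp hsn
  rw [lintegral_const_mul]
  · rw [lintegral_lintegral_swap hGs.aemeasurable, cv m hm G hG]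
    congr 1
    refine setLIntegral_congr_fun (measurableSet_IL m) fun l hl => ?_
    have hl' : IL m l := hl
    simp only [hGdef]
    congr 1
    have hlast : Tmap m l (Fin.last N) = ∑ k, l k - ∑ k, m k := by simp [Tmap]
    rw [hlast]
    congr 1
    apply hf.2 _ _ (border_isHermitian (diag_herm m) _ _) (diag_herm l)
    apply border_diag_IL m hm
    rw [← hlast]
    ext i
    induction i using Fin.lastCases with
    | last => simp
    | cast i =>
      rw [Fin.snoc_castSucc, Complex.normSq_ofReal, Real.mul_self_sqrt (Tmap_pos hl' i).le]
  · exact Measurable.lintegral_prod_right' hGs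

end

section
open Filter Topology
theorem VD_ite {N : ℕ} (x : Fin N → ℝ) : VD x = ∏ i, ∏ j, if i < j then x j - x i else 1 := by
  rw [VD, det_vandermonde]
  refine Finset.prod_congr rfl fun i _ => ?_
  rw [← Finset.prod_filter]
  refine Finset.prod_congr ?_ fun _ _ => rfl
  ext; simp

theorem VD_snoc {N : ℕ} (s : Fin (N+1) → ℝ) :
    VD s = VD (fun i : Fin N => s i.castSucc) * ∏ i : Fin N, (s (Fin.last N) - s i.castSucc) := by
  rw [VD_ite, VD_ite, Fin.prod_univ_castSucc]
  simp only [Fin.prod_univ_castSucc, Fin.castSucc_lt_castSucc_iff, Fin.castSucc_lt_last, if_true, lt_irrefl,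
    if_false, mul_one]
  rw [Finset.prod_mul_distrib]
  have : ∀ j : Fin N, ¬ (Fin.last N < j.castSucc) := fun j => not_lt_of_gt (Fin.castSucc_lt_last j)
  simp [this]

theorem VD_ne {N : ℕ} {s : Fin N → ℝ} (hs : Function.Injective s) : VD s ≠ 0 := by
  rw [VD, det_vandermonde_ne_zero_iff]; exact hs

noncomputable def eD {N : ℕ} (s l : Fin N → ℝ) : ℝ :=
  (Matrix.of fun i j => Real.exp (s i * l j)).det

noncomputable def kd {N : ℕ} (s l : Fin N → ℝ) : ℝ := eD s l / VD s

theorem eD_cont {N : ℕ} (s : Fin N → ℝ) : Continuous (eD s) := by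
  unfold eD
  refine Continuous.matrix_det ?_
  refine continuous_matrix fun i j => ?_
  simp only [Matrix.of_apply]; fun_prop

theorem eD_shift {N : ℕ} (s l : Fin N → ℝ) (S : ℝ) :
    eD s l = Real.exp (S * ∑ k, l k) * eD (fun i => s i - S) l := by
  unfold eD
  rw [Finset.mul_sum, Real.exp_sum]
  rw [← Matrix.det_mul_row (fun j => Real.exp (S * l j))]
  congr 1
  ext i j
  simp only [Matrix.of_apply]
  rw [← Real.exp_add]; congr 1; ring

theorem eD_expand {N : ℕ} (s l : Fin (N+1) → ℝ) (hS : s (Fin.last N) = 0) :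
    eD s l = (-1)^N * (Matrix.of fun i j : Fin N => Real.exp (s i.castSucc * l j.succ) - Real.exp (s i.castSucc * l j.castSucc)).det := by
  unfold eD
  set B : Matrix (Fin (N+1)) (Fin (N+1)) ℝ := Matrix.of fun i j =>
    Fin.cases (motive := fun _ => ℝ) (Real.exp (s i * l 0)) (fun j : Fin N => Real.exp (s i * l j.succ) - Real.exp (s i * l j.castSucc)) j with hB
  rw [Matrix.det_eq_of_forall_col_eq_smul_add_pred (B := B) (fun _ => 1) (by simp [hB]) (by simp [hB])]
  rw [Matrix.det_succ_row B (Fin.last N), Finset.sum_eq_single 0]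
  · simp only [Fin.val_last, Fin.val_zero, add_zero]
    have : B (Fin.last N) 0 = 1 := by simp [hB, hS]
    rw [this, mul_one]
    congr 2
    ext i j
    simp [hB]
  · intro j _ hj
    obtain ⟨j, rfl⟩ := Fin.exists_succ_eq.2 hj
    have : B (Fin.last N) j.succ = 0 := by simp [hB, hS]
    rw [this]; simp
  · simp

theorem IL_set {N : ℕ} (l : Fin (N+1) → ℝ) :
    {m : Fin N → ℝ | IL m l} = Set.univ.pi fun i : Fin N => Set.Ioo (l i.castSucc) (l i.succ) := by
  ext m; simp [IL, Set.mem_pi]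

theorem int_exp_Ioo (c a b : ℝ) (hc : c ≠ 0) (hab : a ≤ b) :
    ∫ x in Set.Ioo a b, Real.exp (c * x) = (Real.exp (c * b) - Real.exp (c * a)) / c := by
  rw [← integral_Ioc_eq_integral_Ioo, ← intervalIntegral.integral_of_le hab]
  rw [intervalIntegral.integral_comp_mul_left (fun x => Real.exp x) hc, integral_exp]
  rw [smul_eq_mul]; field_simp

theorem integrableOn_IL {N : ℕ} (l : Fin (N+1) → ℝ) (g : (Fin N → ℝ) → ℝ) (hg : Continuous g) :
    IntegrableOn g {m : Fin N → ℝ | IL m l} := by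
  have hK : IsCompact (Set.univ.pi fun i : Fin N => Set.Icc (l i.castSucc) (l i.succ)) :=
    isCompact_univ_pi fun i => isCompact_Icc
  refine (hg.continuousOn.integrableOn_compact hK).mono_set ?_
  rw [IL_set]
  exact Set.pi_mono fun i _ => Set.Ioo_subset_Icc_self

theorem int_eD {N : ℕ} (s : Fin N → ℝ) (hs : ∀ i, s i ≠ 0) (l : Fin (N+1) → ℝ) (hl : StrictMono l) :
    ∫ m in {m : Fin N → ℝ | IL m l}, eD s m =
      (Matrix.of fun i j : Fin N => Real.exp (s i * l j.succ) - Real.exp (s i * l j.castSucc)).det / ∏ i, s i := by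
  unfold eD
  simp only [Matrix.det_apply', Matrix.of_apply]
  rw [integral_finsetSum]
  · rw [Finset.sum_div]
    refine Finset.sum_congr rfl fun σ _ => ?_
    rw [integral_const_mul, mul_div_assoc]
    congr 1
    rw [IL_set, volume_pi, Measure.restrict_pi_pi,
      integral_fintype_prod_eq_prod (f := fun j x => Real.exp (s (σ j) * x))]
    rw [← Equiv.prod_comp σ s, ← Finset.prod_div_distrib]
    refine Finset.prod_congr rfl fun j _ => ?_
    exact int_exp_Ioo _ _ _ (hs _) (hl.monotone Fin.castSucc_lt_succ.le)
  · intro σ _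
    exact integrableOn_IL l _ (by fun_prop)

theorem kd_rec {N : ℕ} (s l : Fin (N+1) → ℝ) (hs : Function.Injective s) (hl : StrictMono l) :
    ∫ m in {m : Fin N → ℝ | IL m l}, Real.exp (s (Fin.last N) * (∑ k, l k - ∑ k, m k)) *
      kd (fun i => s i.castSucc) m = kd s l := by
  set S := s (Fin.last N) with hS
  have e : ∀ m : Fin N → ℝ, Real.exp (S * (∑ k, l k - ∑ k, m k)) * kd (fun i => s i.castSucc) m
     = (Real.exp (S * ∑ k, l k) / VD (fun i : Fin N => s i.castSucc)) * eD (fun i : Fin N => s i.castSucc - S) m := by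
    intro m
    rw [kd, eD_shift (fun i : Fin N => s i.castSucc) m S, mul_sub, Real.exp_sub]
    field_simp
  simp only [e]
  have hne : ∀ i : Fin N, s i.castSucc - S ≠ 0 := fun i =>
    sub_ne_zero.2 fun h => (Fin.castSucc_lt_last i).ne (hs h)
  rw [integral_const_mul, int_eD _ hne l hl, kd, eD_shift s l S, eD_expand _ l (by simp [hS]), VD_snoc s]
  have h2 : ∏ i : Fin N, (S - s i.castSucc) = (-1)^N * ∏ i : Fin N, (s i.castSucc - S) := by
    rw [← Fin.prod_const, ← Finset.prod_mul_distrib]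
    refine Finset.prod_congr rfl fun i _ => by ring
  rw [← hS, h2]
  have h3 : VD (fun i : Fin N => s i.castSucc) ≠ 0 := VD_ne (hs.comp (Fin.castSucc_injective N))
  have h4 : ∏ i : Fin N, (s i.castSucc - S) ≠ 0 := Finset.prod_ne_zero_iff.2 fun i _ => hne i
  have h5 : ((-1:ℝ))^N ≠ 0 := by positivity
  field_simp

theorem measurableSet_IL' {N : ℕ} (l : Fin (N+1) → ℝ) : MeasurableSet {m : Fin N → ℝ | IL m l} := by
  rw [IL_set]; exact MeasurableSet.univ_pi fun i => measurableSet_Ioo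

theorem kd_nonneg {N : ℕ} (s l : Fin N → ℝ) (hs : Function.Injective s) (hl : StrictMono l) : 0 ≤ kd s l := by
  induction N with
  | zero => simp [kd, eD, VD]
  | succ N ih =>
    rw [← kd_rec s l hs hl]
    refine setIntegral_nonneg (measurableSet_IL' l) fun m hm => ?_
    have hm' : IL m l := hm
    exact mul_nonneg (Real.exp_nonneg _) (ih _ _ (hs.comp (Fin.castSucc_injective N)) hm'.strictMono_left)

theorem kd_cont {N : ℕ} (s : Fin N → ℝ) : Continuous (kd s) := (eD_cont s).div_const _

theorem kd_rec_l {N : ℕ} (s l : Fin (N+1) → ℝ) (hs : Function.Injective s) (hl : StrictMono l) :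
    ∫⁻ m in {m : Fin N → ℝ | IL m l}, ENNReal.ofReal (Real.exp (s (Fin.last N) * (∑ k, l k - ∑ k, m k))) *
      ENNReal.ofReal (kd (fun i => s i.castSucc) m) = ENNReal.ofReal (kd s l) := by
  rw [← kd_rec s l hs hl, ofReal_integral_eq_lintegral_ofReal]
  · refine lintegral_congr fun m => ?_
    rw [ENNReal.ofReal_mul (Real.exp_nonneg _)]
  · have := kd_cont (fun i : Fin N => s i.castSucc)
    exact integrableOn_IL l _ (by fun_prop)
  · refine (ae_restrict_iff' (measurableSet_IL' l)).2 (Eventually.of_forall fun m hm => ?_)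
    have hm' : IL m l := hm
    exact mul_nonneg (Real.exp_nonneg _) (kd_nonneg _ _ (hs.comp (Fin.castSucc_injective N)) hm'.strictMono_left)

end

section
open Filter Topology
theorem measurableSet_SM {N : ℕ} : MeasurableSet {l : Fin N → ℝ | StrictMono l} := by
  have : {l : Fin N → ℝ | StrictMono l} = ⋂ i, ⋂ j, ⋂ (_ : i < j), {l : Fin N → ℝ | l i < l j} := by
    ext l; simp [StrictMono]
  rw [this]
  exact MeasurableSet.iInter fun i => MeasurableSet.iInter fun j => MeasurableSet.iInter fun _ =>
    measurableSet_lt (by fun_prop) (by fun_prop)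

theorem measurableSet_IL2 {N : ℕ} : MeasurableSet {q : (Fin N → ℝ) × (Fin (N+1) → ℝ) | IL q.1 q.2} := by
  have : {q : (Fin N → ℝ) × (Fin (N+1) → ℝ) | IL q.1 q.2} =
      ⋂ i : Fin N, ({q | q.2 i.castSucc < q.1 i} ∩ {q | q.1 i < q.2 i.succ}) := by
    ext l; simp [IL]
  rw [this]
  exact MeasurableSet.iInter fun i => (measurableSet_lt (by fun_prop) (by fun_prop)).inter
    (measurableSet_lt (by fun_prop) (by fun_prop))

theorem ClassFn.meas_diag {N : ℕ} {f : Matrix (Fin N) (Fin N) ℂ → ENNReal} (hf : ClassFn f) :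
    Measurable fun l : Fin N → ℝ => f (Matrix.diagonal fun i => (l i : ℂ)) := by
  simp only [← hermOf_diag_s11]
  exact hf.1.comp (f := fun l : Fin N → ℝ => ((l, 0) : HCoords N)) (by fun_prop)

theorem main_swap {N : ℕ} {f : Matrix (Fin (N+1)) (Fin (N+1)) ℂ → ENNReal} (hf : ClassFn f)
    (s : Fin (N+1) → ℝ) (hs : Function.Injective s) :
    ∫⁻ m in {m : Fin N → ℝ | StrictMono m}, (∫⁻ l in {l | IL m l},
        ENNReal.ofReal (VD l / VD m) * (f (Matrix.diagonal fun i => (l i : ℂ)) *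
          ENNReal.ofReal (Real.exp (s (Fin.last N) * (∑ k, l k - ∑ k, m k))))) *
        (ENNReal.ofReal (VD m) * ENNReal.ofReal (kd (fun i => s i.castSucc) m)) =
    ∫⁻ l in {l : Fin (N+1) → ℝ | StrictMono l}, f (Matrix.diagonal fun i => (l i : ℂ)) *
        (ENNReal.ofReal (VD l) * ENNReal.ofReal (kd s l)) := by
  set s' : Fin N → ℝ := fun i => s i.castSucc with hs'
  set K : (Fin N → ℝ) × (Fin (N+1) → ℝ) → ENNReal := fun q =>
    (f (Matrix.diagonal fun i => (q.2 i : ℂ)) * ENNReal.ofReal (VD q.2)) *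
      (ENNReal.ofReal (Real.exp (s (Fin.last N) * (∑ k, q.2 k - ∑ k, q.1 k))) * ENNReal.ofReal (kd s' q.1)) with hK
  have hVm : ∀ n, Measurable (VD (N := n)) := fun n => VD_cont.measurable
  have hkm : Measurable (kd s') := (kd_cont s').measurable
  have hKm : Measurable K := by
    have h1 := hf.meas_diag
    have h2 : Measurable fun q : (Fin N → ℝ) × (Fin (N+1) → ℝ) => f (Matrix.diagonal fun i => (q.2 i : ℂ)) :=
      h1.comp measurable_snd
    have h3 := hVm (N+1)
    exact (h2.mul (h3.comp measurable_snd).ennreal_ofReal).mul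
      ((by fun_prop : Measurable _).mul (hkm.comp measurable_fst).ennreal_ofReal)
  set T := {q : (Fin N → ℝ) × (Fin (N+1) → ℝ) | IL q.1 q.2} with hT
  have hTm : MeasurableSet T := measurableSet_IL2
  have hKi := hKm.indicator hTm
  have e1 : ∀ m : Fin N → ℝ, ∀ l, IL m l →
      ENNReal.ofReal (VD l / VD m) * (f (Matrix.diagonal fun i => (l i : ℂ)) *
          ENNReal.ofReal (Real.exp (s (Fin.last N) * (∑ k, l k - ∑ k, m k)))) *
        (ENNReal.ofReal (VD m) * ENNReal.ofReal (kd s' m)) = K (m, l) := by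
    intro m l h
    have h1 := VD_pos h.strictMono_left
    have h2 := VD_pos h.strictMono
    have h3 : ENNReal.ofReal (VD l) = ENNReal.ofReal (VD l / VD m) * ENNReal.ofReal (VD m) := by
      rw [← ENNReal.ofReal_mul (by positivity), div_mul_cancel₀ _ h1.ne']
    simp only [hK]
    rw [h3]; ring
  have L : ∫⁻ m in {m : Fin N → ℝ | StrictMono m}, (∫⁻ l in {l | IL m l},
        ENNReal.ofReal (VD l / VD m) * (f (Matrix.diagonal fun i => (l i : ℂ)) *
          ENNReal.ofReal (Real.exp (s (Fin.last N) * (∑ k, l k - ∑ k, m k))))) *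
        (ENNReal.ofReal (VD m) * ENNReal.ofReal (kd s' m)) =
      ∫⁻ m, ∫⁻ l, T.indicator K (m, l) := by
    rw [← lintegral_indicator measurableSet_SM]
    refine lintegral_congr fun m => ?_
    by_cases hm : StrictMono m
    · rw [Set.indicator_of_mem (by exact hm)]
      rw [← lintegral_mul_const' _ _ (by finiteness), ← lintegral_indicator (measurableSet_IL m)]
      refine lintegral_congr fun l => ?_
      by_cases h : IL m l
      · rw [Set.indicator_of_mem (by exact h), Set.indicator_of_mem (by exact h), e1 m l h]
      · rw [Set.indicator_of_notMem (by exact h), Set.indicator_of_notMem (by exact h)]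
    · rw [Set.indicator_of_notMem (by exact hm)]
      symm
      refine (lintegral_congr fun l => ?_).trans lintegral_zero
      exact Set.indicator_of_notMem (fun h => hm (IL.strictMono_left h)) _
  have R : ∫⁻ l in {l : Fin (N+1) → ℝ | StrictMono l}, f (Matrix.diagonal fun i => (l i : ℂ)) *
        (ENNReal.ofReal (VD l) * ENNReal.ofReal (kd s l)) = ∫⁻ l, ∫⁻ m, T.indicator K (m, l) := by
    rw [← lintegral_indicator measurableSet_SM]
    refine lintegral_congr fun l => ?_
    by_cases hl : StrictMono l
    · rw [Set.indicator_of_mem (by exact hl), ← kd_rec_l s l hs hl, ← mul_assoc]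
      rw [← lintegral_const_mul, ← lintegral_indicator (measurableSet_IL' l)]
      · refine lintegral_congr fun m => ?_
        by_cases h : IL m l
        · rw [Set.indicator_of_mem (by exact h), Set.indicator_of_mem (by exact h)]
        · rw [Set.indicator_of_notMem (by exact h), Set.indicator_of_notMem (by exact h)]
      · exact (by fun_prop : Measurable _).mul hkm.ennreal_ofReal
    · rw [Set.indicator_of_notMem (by exact hl)]
      symm
      refine (lintegral_congr fun l => ?_).trans lintegral_zero
      exact Set.indicator_of_notMem (fun h => hl (IL.strictMono h)) _
  rw [L, R]
  exact lintegral_lintegral_swap hKi.aemeasurable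

theorem HC (N : ℕ) : ∃ K : ENNReal, K ≠ 0 ∧ K ≠ ⊤ ∧ ∀ s : Fin N → ℝ, Function.Injective s →
    ∀ f : Matrix (Fin N) (Fin N) ℂ → ENNReal, ClassFn f →
    ∫⁻ c : HCoords N, f (hermOf c) * ENNReal.ofReal (Real.exp (∑ i, s i * c.1 i)) =
      K * ∫⁻ l in {l : Fin N → ℝ | StrictMono l}, f (Matrix.diagonal fun i => (l i : ℂ)) *
        (ENNReal.ofReal (VD l) * ENNReal.ofReal (kd s l)) := by
  induction N with
  | zero =>
    refine ⟨1, one_ne_zero, ENNReal.one_ne_top, fun s _ f _ => ?_⟩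
    have : IsEmpty (OffIdx 0) := ⟨fun p => p.1.1.elim0⟩
    let _ : Unique (HCoords 0) := ⟨⟨(0, 0)⟩, fun c => Subsingleton.elim _ _⟩
    have e : {l : Fin 0 → ℝ | StrictMono l} = Set.univ := by
      ext l; simp [StrictMono]
    rw [e, Measure.restrict_univ, Measure.volume_eq_prod, lintegral_unique, lintegral_unique]
    have : ∀ A B : Matrix (Fin 0) (Fin 0) ℂ, f A = f B := fun A B => congrArg f (Subsingleton.elim A B)
    simp only [volume_pi]
    simp [kd, eD, VD, ← Set.univ_prod_univ, Measure.prod_prod]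
    exact this _ _
  | succ N ih =>
    obtain ⟨K, h0, ht, h⟩ := ih
    refine ⟨K * ENNReal.ofReal Real.pi ^ N, ?_, ?_, ?_⟩
    · refine mul_ne_zero h0 (pow_ne_zero _ ?_)
      simp [Real.pi_pos]
    · finiteness
    intro s hs f hf
    have hm1 : Measurable fun c : HCoords (N+1) => f (hermOf c) * ENNReal.ofReal (Real.exp (∑ i, s i * c.1 i)) :=
      hf.1.mul (by fun_prop)
    rw [lintegral_joinC _ hm1]
    have e : ∀ c : HCoords N, ∫⁻ x : ℝ, ∫⁻ v : Fin N → ℂ, f (hermOf (joinC (c, (x, v)))) *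
        ENNReal.ofReal (Real.exp (∑ i, s i * (joinC (c, (x, v))).1 i)) =
        gfun f (s (Fin.last N)) (hermOf c) * ENNReal.ofReal (Real.exp (∑ i : Fin N, s i.castSucc * c.1 i)) := by
      intro c
      unfold gfun
      rw [← lintegral_mul_const' _ _ (by finiteness)]
      refine lintegral_congr fun x => ?_
      rw [← lintegral_mul_const' _ _ (by finiteness)]
      refine lintegral_congr fun v => ?_
      rw [hermOf_joinC, mul_assoc, ← ENNReal.ofReal_mul (Real.exp_nonneg _), ← Real.exp_add]
      congr 3
      rw [Fin.sum_univ_castSucc]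
      simp [joinC, add_comm]
    simp only [e]
    rw [h (fun i => s i.castSucc) (hs.comp (Fin.castSucc_injective N)) _ (hf.gfun _), mul_assoc]
    congr 1
    rw [← main_swap hf s hs, ← lintegral_const_mul' _ _ (by finiteness)]
    refine setLIntegral_congr_fun measurableSet_SM fun m hm => ?_
    have hm' : StrictMono m := hm
    simp only [gfun_diag hf _ m hm']
    rw [mul_assoc]

end

section
open Filter Topology
theorem perm_mp {N : ℕ} (τ : Equiv.Perm (Fin N)) :
    MeasurePreserving (fun l : Fin N → ℝ => l ∘ τ) volume volume := by
  have h := volume_measurePreserving_piCongrLeft (fun _ : Fin N => ℝ) τ.symm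
  convert h using 1
  ext l i
  have := MeasurableEquiv.piCongrLeft_apply_apply (β := fun _ : Fin N => ℝ) τ.symm l (τ i)
  simpa using this.symm

theorem ae_injective {N : ℕ} : ∀ᵐ l : Fin N → ℝ, Function.Injective l := by
  have h : ∀ i j : Fin N, i ≠ j → ∀ᵐ l : Fin N → ℝ, l i ≠ l j := by
    intro i j hij
    set S : Submodule ℝ (Fin N → ℝ) :=
      LinearMap.ker ((LinearMap.proj (R := ℝ) (φ := fun _ => ℝ) i) - LinearMap.proj (R := ℝ) (φ := fun _ => ℝ) j)
    have hS : S ≠ ⊤ := by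
      intro h
      have : (Pi.single i 1 : Fin N → ℝ) ∈ S := by rw [h]; trivial
      simp [S, hij.symm] at this
    have h0 := Measure.addHaar_submodule (volume : Measure (Fin N → ℝ)) S hS
    rw [ae_iff]
    convert h0 using 2
    ext l; simp [S, sub_eq_zero]
  have h2 : ∀ᵐ l : Fin N → ℝ, ∀ i j : Fin N, i ≠ j → l i ≠ l j := by
    rw [ae_all_iff]; intro i
    rw [ae_all_iff]; intro j
    by_cases hij : i = j
    · simp [hij]
    · filter_upwards [h i j hij] with l hl _ using hl
  filter_upwards [h2] with l hl i j hij
  by_contra hne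
  exact hl i j hne hij

theorem chamber {N : ℕ} (g : (Fin N → ℝ) → ℝ) (hg : Integrable g) :
    ∑ τ : Equiv.Perm (Fin N), ∫ l in {l : Fin N → ℝ | StrictMono l}, g (l ∘ τ) = ∫ l, g l := by
  have hset : ∀ τ : Equiv.Perm (Fin N), MeasurableSet {l : Fin N → ℝ | StrictMono (l ∘ τ.symm)} := fun τ =>
    (perm_mp τ.symm).measurable measurableSet_SM
  have e : ∀ τ : Equiv.Perm (Fin N), ∫ l in {l : Fin N → ℝ | StrictMono l}, g (l ∘ τ) =
      ∫ l in {l : Fin N → ℝ | StrictMono (l ∘ τ.symm)}, g l := by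
    intro τ
    have hemb : MeasurableEmbedding (fun l : Fin N → ℝ => l ∘ τ) := by
      let me : (Fin N → ℝ) ≃ᵐ (Fin N → ℝ) :=
        { toFun := fun l => l ∘ τ
          invFun := fun l => l ∘ τ.symm
          left_inv := fun l => by ext; simp
          right_inv := fun l => by ext; simp
          measurable_toFun := (perm_mp τ).measurable
          measurable_invFun := (perm_mp τ.symm).measurable }
      exact me.measurableEmbedding
    rw [← (perm_mp τ).setIntegral_preimage_emb hemb g {l : Fin N → ℝ | StrictMono (l ∘ τ.symm)}]
    congr 2
    ext l
    simp only [Set.mem_preimage, Set.mem_ofPred_eq]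
    rw [show (l ∘ ⇑τ) ∘ ⇑(Equiv.symm τ) = l by ext; simp]
  simp only [e]
  rw [← integral_iUnion_fintype hset _ (fun τ => hg.integrableOn)]
  · rw [setIntegral_eq_integral_of_ae_compl_eq_zero]
    filter_upwards [ae_injective] with l hl hn
    exfalso; apply hn
    rw [Set.mem_iUnion]
    refine ⟨(Tuple.sort l).symm, ?_⟩
    simp only [Set.mem_ofPred_eq, Equiv.symm_symm]
    exact (Tuple.monotone_sort l).strictMono_of_injective (hl.comp (Equiv.injective _))
  · intro σ τ hne
    rw [Function.onFun, Set.disjoint_left]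
    intro l h1 h2
    apply hne
    have h1' : StrictMono (l ∘ σ.symm) := h1
    have h2' : StrictMono (l ∘ τ.symm) := h2
    have hinj : Function.Injective l := by
      have := h1'.injective.comp σ.injective
      rwa [show (l ∘ ⇑(Equiv.symm σ)) ∘ ⇑σ = l by ext; simp] at this
    have h3 : l ∘ σ.symm = l ∘ τ.symm := by
      apply (h1'.range_inj h2').1
      rw [Set.range_comp, Set.range_comp]; simp
    have h4 : σ.symm = τ.symm := by
      ext i
      have := hinj (congrFun h3 i)
      rw [this]
    have := congrArg Equiv.symm h4
    simpa using this

theorem VD_comp_perm {N : ℕ} (l : Fin N → ℝ) (τ : Equiv.Perm (Fin N)) :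
    VD (l ∘ τ) = (Equiv.Perm.sign τ : ℝ) * VD l := by
  unfold VD
  rw [← Matrix.det_permute]
  rfl

theorem VD_expand {N : ℕ} (l : Fin N → ℝ) :
    VD l = ∑ σ : Equiv.Perm (Fin N), (Equiv.Perm.sign σ : ℝ) * ∏ j, l j ^ (σ j : ℕ) := by
  unfold VD
  rw [← Matrix.det_transpose, Matrix.det_apply']
  simp [vandermonde]

theorem andreief {N : ℕ} (w : ℝ → ℝ) (s : Fin N → ℝ)
    (hw : ∀ (k : ℕ) (t : ℝ), Integrable fun x => w x * (x ^ k * Real.exp (t * x))) :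
    (∫ l in {l : Fin N → ℝ | StrictMono l}, (∏ i, w (l i)) * (VD l * eD s l)) =
      (Matrix.of fun i j : Fin N => ∫ x, w x * (x ^ (i : ℕ) * Real.exp (s j * x))).det ∧
    Integrable (fun l : Fin N → ℝ => (∏ i, w (l i)) * (VD l * eD s l)) := by
  set g : (Fin N → ℝ) → ℝ := fun l => (∏ i, w (l i)) * (VD l * Real.exp (∑ j, s j * l j)) with hgdef
  have e1 : g = fun l => ∑ σ : Equiv.Perm (Fin N), (Equiv.Perm.sign σ : ℝ) *
      ∏ j, (w (l j) * (l j ^ (σ j : ℕ) * Real.exp (s j * l j))) := by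
    ext l
    simp only [hgdef]
    rw [VD_expand, Finset.sum_mul, Finset.mul_sum]
    refine Finset.sum_congr rfl fun σ _ => ?_
    rw [Real.exp_sum, Finset.prod_mul_distrib, Finset.prod_mul_distrib]
    ring
  have hint : ∀ σ : Equiv.Perm (Fin N), Integrable fun l : Fin N → ℝ =>
      (Equiv.Perm.sign σ : ℝ) * ∏ j, (w (l j) * (l j ^ (σ j : ℕ) * Real.exp (s j * l j))) := fun σ =>
    (Integrable.fintype_prod (f := fun j x => w x * (x ^ (σ j : ℕ) * Real.exp (s j * x)))
      (fun j => hw _ _)).const_mul _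
  have hg : Integrable g := by
    rw [e1]; exact integrable_finsetSum _ fun σ _ => hint σ
  have e2 : ∀ l : Fin N → ℝ, (∏ i, w (l i)) * (VD l * eD s l) = ∑ τ : Equiv.Perm (Fin N), g (l ∘ τ) := by
    intro l
    unfold eD
    rw [Matrix.det_apply', Finset.mul_sum, Finset.mul_sum, ← Equiv.sum_comp (Equiv.inv (Equiv.Perm (Fin N)))]
    refine Finset.sum_congr rfl fun τ _ => ?_
    simp only [hgdef, VD_comp_perm, Function.comp]
    rw [Equiv.prod_comp τ (fun i => w (l i)), ← Equiv.sum_comp τ.symm (fun j => s j * l (τ j)), Real.exp_sum]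
    simp only [Equiv.inv_apply, Equiv.Perm.sign_symm, Equiv.apply_symm_apply, Matrix.of_apply, Equiv.Perm.inv_def]
    ring
  have hgp : ∀ τ : Equiv.Perm (Fin N), Integrable (fun l => g (l ∘ τ)) := fun τ =>
    (perm_mp τ).integrable_comp_of_integrable hg
  constructor
  · simp only [e2]
    rw [integral_finsetSum _ fun τ _ => (hgp τ).integrableOn, chamber g hg, e1,
      integral_finsetSum _ fun σ _ => hint σ, Matrix.det_apply']
    refine Finset.sum_congr rfl fun σ _ => ?_
    rw [integral_const_mul, volume_pi,
      integral_fintype_prod_eq_prod (f := fun j x => w x * (x ^ (σ j : ℕ) * Real.exp (s j * x)))]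
    simp
  · simp only [e2]
    exact integrable_finsetSum _ fun τ _ => hgp τ

end

section
open Filter Topology
noncomputable def wt (k : ℝ) (x : ℝ) : ℝ := Real.exp (-k * x ^ 4)

theorem wt_exp_int {k : ℝ} (hk : 0 < k) (t : ℝ) : Integrable fun x => wt k x * Real.exp (t * x) := by
  have h := (integrable_exp_neg_mul_sq (b := 1) one_pos).const_mul (Real.exp (1 / k + t ^ 2 / 4))
  refine h.mono' (by unfold wt; fun_prop) (Eventually.of_forall fun x => ?_)
  rw [wt, ← Real.exp_add, ← Real.exp_add, Real.norm_eq_abs, Real.abs_exp]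
  apply Real.exp_le_exp.2
  have h1 : 0 ≤ k * (x ^ 2 - 1 / k) ^ 2 := by positivity
  have h2 : k * (x ^ 2 - 1 / k) ^ 2 = k * x ^ 4 - 2 * x ^ 2 + 1 / k := by field_simp; ring
  nlinarith [sq_nonneg (x - t / 2)]

noncomputable def wm (k : ℝ) : Measure ℝ := volume.withDensity fun x => ENNReal.ofReal (wt k x)

theorem wt_pos (k x : ℝ) : 0 < wt k x := Real.exp_pos _

theorem wt_cont (k : ℝ) : Continuous (wt k) := by unfold wt; fun_prop

theorem wm_integral (k : ℝ) (g : ℝ → ℝ) : ∫ x, g x ∂(wm k) = ∫ x, wt k x * g x := by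
  unfold wm
  rw [integral_withDensity_eq_integral_toReal_smul (wt_cont k).measurable.ennreal_ofReal
    (Eventually.of_forall fun x => ENNReal.ofReal_lt_top)]
  simp [ENNReal.toReal_ofReal (wt_pos k _).le]

theorem wm_integrable (k : ℝ) (g : ℝ → ℝ) : Integrable g (wm k) ↔ Integrable fun x => wt k x * g x := by
  unfold wm
  rw [integrable_withDensity_iff_integrable_smul' (wt_cont k).measurable.ennreal_ofReal
    (Eventually.of_forall fun x => ENNReal.ofReal_lt_top)]
  simp [ENNReal.toReal_ofReal (wt_pos k _).le]

theorem wm_expset {k : ℝ} (hk : 0 < k) (v : ℝ) :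
    ProbabilityTheory.integrableExpSet (fun x => v * x) (wm k) = Set.univ := by
  ext t
  simp only [ProbabilityTheory.integrableExpSet, Set.mem_ofPred_eq, Set.mem_univ, iff_true]
  rw [wm_integrable]
  simpa [mul_assoc] using wt_exp_int hk (t * v)

theorem wt_int {k : ℝ} (hk : 0 < k) (n : ℕ) (t : ℝ) :
    Integrable fun x => wt k x * (x ^ n * Real.exp (t * x)) := by
  rw [← wm_integrable k (fun x => x ^ n * Real.exp (t * x))]
  have h := wm_expset hk 1
  have := ProbabilityTheory.integrable_pow_mul_exp_of_mem_interior_integrableExpSet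
    (X := fun x : ℝ => 1 * x) (μ := wm k) (v := t) (by rw [h]; simp) n
  simpa using this

theorem Pint_mgf (Vc lam : ℝ) : Pint Vc lam = ProbabilityTheory.mgf (fun x => Vc * x) (wm (lam * Vc / 4)) := by
  ext z
  rw [ProbabilityTheory.mgf, wm_integral, Pint]
  congr 1
  ext x
  rw [wt, ← Real.exp_add]
  congr 1; ring

theorem Pint_iter {Vc lam : ℝ} (hk : 0 < lam * Vc / 4) (n : ℕ) (z : ℝ) :
    iteratedDeriv n (Pint Vc lam) z =
      Vc ^ n * ∫ x, wt (lam * Vc / 4) x * (x ^ n * Real.exp ((Vc * z) * x)) := by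
  rw [Pint_mgf, ProbabilityTheory.iteratedDeriv_mgf (by rw [wm_expset hk]; simp), wm_integral,
    ← integral_const_mul]
  congr 1
  ext x
  rw [mul_pow, show z * (Vc * x) = Vc * z * x by ring]; ring

theorem Pint_diff {Vc lam : ℝ} (hk : 0 < lam * Vc / 4) (n : ℕ) :
    Differentiable ℝ (iteratedDeriv n (Pint Vc lam)) := by
  intro z
  rw [Pint_mgf]
  exact ProbabilityTheory.differentiableAt_iteratedDeriv_mgf (by rw [wm_expset hk]; simp) n

noncomputable def Dc (N : ℕ) (Vc : ℝ) : ℝ := ∏ i : Fin N, Vc ^ (i : ℕ)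

theorem PNdet_eq {N : ℕ} {Vc lam : ℝ} (hk : 0 < lam * Vc / 4) (s : Fin N → ℝ) :
    PNdet N Vc lam s = Dc N Vc *
      (Matrix.of fun i j : Fin N => ∫ x, wt (lam * Vc / 4) x * (x ^ (i : ℕ) * Real.exp ((Vc * s j) * x))).det := by
  rw [PNdet, Dc, ← Matrix.det_mul_column]
  congr 1
  ext i j
  simp [Pint_iter hk]

theorem VD_smul {N : ℕ} (Vc : ℝ) (s : Fin N → ℝ) : VD (fun i => Vc * s i) = Dc N Vc * VD s := by
  rw [VD, VD, Dc, ← Matrix.det_mul_row]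
  congr 1
  ext i j
  simp [vandermonde, mul_pow]

noncomputable def ffun (N : ℕ) (k : ℝ) (A : Matrix (Fin N) (Fin N) ℂ) : ENNReal :=
  ENNReal.ofReal (Real.exp (-k * (Matrix.trace (A ^ 4)).re))

theorem hermOf_cont {N : ℕ} : Continuous (hermOf (N := N)) := by
  refine continuous_matrix fun i j => ?_
  rcases lt_trichotomy i j with h | h | h
  · simp only [hermOf, Matrix.of_apply, h, dite_true]; fun_prop
  · subst h; simp only [hermOf, Matrix.of_apply, lt_irrefl, dite_false]; fun_prop
  · simp only [hermOf, Matrix.of_apply, h, not_lt_of_gt h, dite_false, dite_true]; fun_prop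

theorem ffun_class (N : ℕ) (k : ℝ) : ClassFn (ffun N k) := by
  refine ⟨?_, ?_⟩
  · have h := hermOf_cont (N := N)
    have : Continuous fun c : HCoords N => Real.exp (-k * (Matrix.trace ((hermOf c) ^ 4)).re) := by
      have h2 : Continuous fun c : HCoords N => Matrix.trace ((hermOf c) ^ 4) := (h.pow 4).matrix_trace
      fun_prop
    exact this.measurable.ennreal_ofReal
  · intro A B hA hB h
    obtain ⟨U, h1, h2, rfl⟩ := herm_conj hA hB h
    unfold ffun
    have : (U * A * star U) ^ 4 = U * A ^ 4 * star U := by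
      have : ∀ n : ℕ, (U * A * star U) ^ n = U * A ^ n * star U := by
        intro n
        induction n with
        | zero => simp [h1]
        | succ n ih =>
          rw [pow_succ, ih, pow_succ]
          calc U * A ^ n * star U * (U * A * star U) = U * A ^ n * (star U * U) * A * star U := by
                simp only [mul_assoc]
            _ = _ := by rw [h2]; simp only [mul_assoc, one_mul]
      exact this 4
    rw [this, Matrix.trace_mul_comm, ← mul_assoc, h2, one_mul]

theorem ffun_diag (N : ℕ) (k : ℝ) (l : Fin N → ℝ) :
    ffun N k (Matrix.diagonal fun i => (l i : ℂ)) = ENNReal.ofReal (∏ i, wt k (l i)) := by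
  unfold ffun wt
  rw [Matrix.diagonal_pow, Matrix.trace_diagonal, ← Real.exp_sum, ← Finset.mul_sum]
  congr 4
  rw [Complex.re_sum]
  refine Finset.sum_congr rfl fun i _ => ?_
  rw [Pi.pow_apply, ← Complex.ofReal_pow, Complex.ofReal_re]

noncomputable def Ffun (N : ℕ) (Vc lam : ℝ) (s : Fin N → ℝ) : ℝ :=
  ∫ c : HCoords N, Real.exp (-(lam * Vc / 4) * (Matrix.trace ((hermOf c) ^ 4)).re + Vc * ∑ i, s i * c.1 i)

theorem Fmain (N : ℕ) {Vc lam : ℝ} (hV : 0 < Vc) (hl : 0 < lam) :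
    ∃ K : ℝ, 0 < K ∧ ∀ s : Fin N → ℝ, Function.Injective s →
      Ffun N Vc lam s = K * (PNdet N Vc lam s / VD s) ∧ 0 < PNdet N Vc lam s / VD s := by
  set k := lam * Vc / 4 with hkdef
  have hk : 0 < k := by positivity
  obtain ⟨K, h0, ht, h⟩ := HC N
  have hD : 0 < Dc N Vc := Finset.prod_pos fun i _ => by positivity
  have hK : 0 < K.toReal := ENNReal.toReal_pos h0 ht
  refine ⟨K.toReal / (Dc N Vc) ^ 2, by positivity, fun s hs => ?_⟩
  set q := PNdet N Vc lam s / VD s with hq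
  have hs' : Function.Injective fun i => Vc * s i := fun i j hij => hs (mul_left_cancel₀ hV.ne' hij)
  have h1 := h (fun i => Vc * s i) hs' (ffun N k) (ffun_class N k)
  obtain ⟨a1, a2⟩ := andreief (wt k) (fun i => Vc * s i) (wt_int hk)
  have a3 := PNdet_eq hk s
  rw [← a1] at a3
  set I := ∫ l in {l : Fin N → ℝ | StrictMono l}, (∏ i, wt k (l i)) * (VD l * eD (fun i => Vc * s i) l) with hI
  have h2 : ∫⁻ l in {l : Fin N → ℝ | StrictMono l}, ffun N k (Matrix.diagonal fun i => (l i : ℂ)) *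
        (ENNReal.ofReal (VD l) * ENNReal.ofReal (kd (fun i => Vc * s i) l)) = ENNReal.ofReal (q / Dc N Vc ^ 2) := by
    have e : q / Dc N Vc ^ 2 = ∫ l in {l : Fin N → ℝ | StrictMono l}, ((∏ i, wt k (l i)) * (VD l * eD (fun i => Vc * s i) l)) / VD (fun i => Vc * s i) := by
      rw [integral_div, ← hI, hq, a3, VD_smul]
      have := VD_ne hs
      field_simp
    rw [e, ofReal_integral_eq_lintegral_ofReal]
    · refine setLIntegral_congr_fun measurableSet_SM fun l hl => ?_
      have hl' : StrictMono l := hl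
      rw [ffun_diag, ← ENNReal.ofReal_mul (VD_pos hl').le, ← ENNReal.ofReal_mul
        (Finset.prod_nonneg fun i _ => (wt_pos _ _).le), kd]
      congr 1; ring
    · exact (a2.div_const _).integrableOn
    · refine (ae_restrict_iff' measurableSet_SM).2 (Eventually.of_forall fun l hl => ?_)
      have hl' : StrictMono l := hl
      have h3 := kd_nonneg _ _ hs' hl'
      have h4 : (∏ i, wt k (l i)) * (VD l * eD (fun i => Vc * s i) l) / VD (fun i => Vc * s i) =
        (∏ i, wt k (l i)) * (VD l * kd (fun i => Vc * s i) l) := by rw [kd]; ring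
      simp only [h4]
      exact mul_nonneg (Finset.prod_nonneg fun i _ => (wt_pos _ _).le) (mul_nonneg (VD_pos hl').le h3)
  rw [h2] at h1
  have hcont : Continuous fun c : HCoords N => Real.exp (-k * (Matrix.trace ((hermOf c) ^ 4)).re + Vc * ∑ i, s i * c.1 i) := by
    have h2 : Continuous fun c : HCoords N => Matrix.trace ((hermOf c) ^ 4) := (hermOf_cont.pow 4).matrix_trace
    fun_prop
  have h3 : ∫⁻ c : HCoords N, ENNReal.ofReal (Real.exp (-k * (Matrix.trace ((hermOf c) ^ 4)).re + Vc * ∑ i, s i * c.1 i))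
      = K * ENNReal.ofReal (q / Dc N Vc ^ 2) := by
    rw [← h1]
    refine lintegral_congr fun c => ?_
    rw [ffun, ← ENNReal.ofReal_mul (Real.exp_nonneg _), ← Real.exp_add, Finset.mul_sum]
    simp only [mul_assoc]
  have hF : Ffun N Vc lam s = (K * ENNReal.ofReal (q / Dc N Vc ^ 2)).toReal := by
    rw [← h3, Ffun, integral_eq_lintegral_of_nonneg_ae (Eventually.of_forall fun c => (Real.exp_nonneg _))
      hcont.aestronglyMeasurable]
  have hint : Integrable fun c : HCoords N => Real.exp (-k * (Matrix.trace ((hermOf c) ^ 4)).re + Vc * ∑ i, s i * c.1 i) := by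
    refine ⟨hcont.aestronglyMeasurable, ?_⟩
    rw [hasFiniteIntegral_iff_ofReal (Eventually.of_forall fun c => (Real.exp_nonneg _)), h3]
    exact ENNReal.mul_lt_top ht.lt_top ENNReal.ofReal_lt_top
  have hnz : NeZero (volume : Measure (HCoords N)) := by
    refine ⟨fun h => ?_⟩
    have h4 : (volume : Measure (HCoords N)) Set.univ ≠ 0 := by
      rw [Measure.volume_eq_prod, ← Set.univ_prod_univ, Measure.prod_prod]
      exact mul_ne_zero (isOpen_univ.measure_ne_zero _ Set.univ_nonempty)
        (isOpen_univ.measure_ne_zero _ Set.univ_nonempty)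
    exact h4 (by rw [h]; simp)
  have hpos : 0 < Ffun N Vc lam s := integral_exp_pos hint
  have hqpos : 0 < q / Dc N Vc ^ 2 := by
    by_contra hn
    rw [hF, ENNReal.ofReal_of_nonpos (not_lt.1 hn)] at hpos
    simp at hpos
  refine ⟨?_, ?_⟩
  · rw [hF, ENNReal.toReal_mul, ENNReal.toReal_ofReal hqpos.le]; ring
  · have := mul_pos hqpos (pow_pos hD 2)
    rwa [div_mul_cancel₀ _ (by positivity)] at this

end

section
open Filter Topology
theorem trace_four {N : ℕ} (F A : Matrix (Fin N) (Fin N) ℂ) :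
    Matrix.trace ((F + A) ^ 4) = Matrix.trace (F ^ 4) + 4 * Matrix.trace (A * F ^ 3) +
      4 * Matrix.trace (A * A * F ^ 2) + 2 * Matrix.trace (A * F * A * F) + 4 * Matrix.trace (A * A * A * F)
      + Matrix.trace (A ^ 4) := by
  have h : ∀ a b c d : Matrix (Fin N) (Fin N) ℂ, Matrix.trace (a * (b * (c * d))) = Matrix.trace (b * (c * (d * a))) := by
    intro a b c d
    rw [Matrix.trace_mul_comm]; simp only [mul_assoc]
  simp only [pow_succ, pow_zero, one_mul, mul_add, add_mul, mul_assoc, Matrix.trace_add]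
  rw [h F F F A, h F F A F, h F A F F, h A F F A, h F F A A, h F A A F, h F A F A, h A A F A, h A F A A, h F A A A]
  ring

theorem act_aux {N : ℕ} (F A : Matrix (Fin N) (Fin N) ℂ) (r kap : ℂ) :
    Matrix.trace ((r ^ 2 • (A * A)) * F ^ 2 + kap • F
      + (1 / 2 : ℂ) • ((r • A) * F * (r • A) * F)
      + r • ((r • A) * F ^ 3) + (r ^ 2 / 4) • F ^ 4) =
    r ^ 2 / 4 * Matrix.trace ((F + A) ^ 4) - r ^ 2 * Matrix.trace (A * A * A * F) - r ^ 2 / 4 * Matrix.trace (A ^ 4)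
      + kap * Matrix.trace F := by
  rw [trace_four]
  simp only [Matrix.trace_add, Matrix.trace_smul, smul_mul_assoc, mul_smul_comm, smul_eq_mul]
  ring

theorem hermOf_add_diag {N : ℕ} (c : HCoords N) (d : Fin N → ℝ) :
    hermOf (c + (d, 0)) = hermOf c + Matrix.diagonal fun i => (d i : ℂ) := by
  ext i j
  rcases lt_trichotomy i j with h | h | h
  · simp [hermOf, h, h.ne]
  · subst h; simp [hermOf]
  · simp [hermOf, h, h.ne', not_lt_of_gt h]

theorem hermOf_diag_apply {N : ℕ} (c : HCoords N) (i : Fin N) : hermOf c i i = (c.1 i : ℂ) := by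
  simp [hermOf]

theorem exponent_eq {N : ℕ} {Vc lam kap : ℝ} (hl : 0 < lam) (Ev : Fin N → ℝ) (hE : ∀ i, 0 < Ev i)
    (t : Fin N → ℝ) (c : HCoords N) :
    - action N Vc lam kap Ev (hermOf c)
      + Vc * (Matrix.trace ((Matrix.diagonal fun i => (t i : ℂ)) * hermOf c)).re =
    (Vc * ∑ i, (lam / 4 * (√(Ev i) / √lam) ^ 4 - (Ev i ^ ((3:ℝ)/2) / √lam - kap) * (√(Ev i) / √lam))
      + -(Vc * ∑ i, t i * (√(Ev i) / √lam))) +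
    (-(lam * Vc / 4) * (Matrix.trace ((hermOf (c + (fun i => √(Ev i) / √lam, 0))) ^ 4)).re
      + Vc * ∑ i, ((Ev i ^ ((3:ℝ)/2) / √lam - kap) + t i) * (c + (fun i => √(Ev i) / √lam, 0)).1 i) := by
  set r := √lam with hr
  have hr0 : r ≠ 0 := (Real.sqrt_pos.2 hl).ne'
  have hr2 : r ^ 2 = lam := Real.sq_sqrt hl.le
  set a : Fin N → ℝ := fun i => √(Ev i) / r with ha
  set A : Matrix (Fin N) (Fin N) ℂ := Matrix.diagonal fun i => (a i : ℂ) with hA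
  have hM : Mmat N Ev = (r : ℂ) • A := by
    rw [Mmat, hA, ← Matrix.diagonal_smul]
    congr 1; ext i
    simp only [Pi.smul_apply, ha, smul_eq_mul]
    rw [← Complex.ofReal_mul]; congr 1; field_simp
  have hEm : Emat N Ev = (r : ℂ) ^ 2 • (A * A) := by
    rw [Emat, hA, Matrix.diagonal_mul_diagonal, ← Matrix.diagonal_smul]
    congr 1; ext i
    simp only [Pi.smul_apply, ha, smul_eq_mul]
    rw [← Complex.ofReal_mul, ← Complex.ofReal_pow, ← Complex.ofReal_mul]; congr 1
    have := Real.sq_sqrt (hE i).le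
    field_simp
    rw [this]
  have h32 : ∀ i, Ev i ^ ((3:ℝ)/2) / r = r ^ 2 * a i ^ 3 := by
    intro i
    have : Ev i ^ ((3:ℝ)/2) = √(Ev i) ^ 3 := by
      rw [Real.sqrt_eq_rpow, ← Real.rpow_natCast, ← Real.rpow_mul (hE i).le]; norm_num
    rw [this, ha]; field_simp
  have hcast : ((lam : ℂ)) / 4 = (r : ℂ) ^ 2 / 4 := by rw [← hr2]; push_cast; ring
  have e1 : action N Vc lam kap Ev (hermOf c) = Vc * (lam / 4 * (Matrix.trace ((hermOf c + A) ^ 4)).re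
      - ∑ i, lam * a i ^ 3 * c.1 i - lam / 4 * ∑ i, a i ^ 4 + kap * ∑ i, c.1 i) := by
    rw [action, hM, hEm, hcast, act_aux]
    congr 1
    have t1 : Matrix.trace (A * A * A * hermOf c) = ((∑ i, a i ^ 3 * c.1 i : ℝ) : ℂ) := by
      rw [hA, Matrix.diagonal_mul_diagonal, Matrix.diagonal_mul_diagonal, Matrix.trace]
      push_cast
      refine Finset.sum_congr rfl fun i _ => ?_
      rw [Matrix.diag_apply, Matrix.diagonal_mul, hermOf_diag_apply]; ring
    have t2 : Matrix.trace (A ^ 4) = ((∑ i, a i ^ 4 : ℝ) : ℂ) := by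
      rw [hA, Matrix.diagonal_pow, Matrix.trace_diagonal]
      push_cast
      rfl
    have t3 : Matrix.trace (hermOf c) = ((∑ i, c.1 i : ℝ) : ℂ) := by
      rw [Matrix.trace]; push_cast
      exact Finset.sum_congr rfl fun i _ => hermOf_diag_apply c i
    rw [t1, t2, t3]
    have : (r : ℂ) ^ 2 = ((lam : ℝ) : ℂ) := by rw [← hr2]; push_cast; ring
    rw [this]
    have h4 : (lam : ℂ) / 4 = ((lam / 4 : ℝ) : ℂ) := by push_cast; ring
    rw [h4]
    simp only [Complex.add_re, Complex.sub_re, Complex.re_ofReal_mul, Complex.ofReal_re]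
    rw [Finset.mul_sum]
    simp only [mul_assoc]
  have e2 : (Matrix.trace ((Matrix.diagonal fun i => (t i : ℂ)) * hermOf c)).re = ∑ i, t i * c.1 i := by
    rw [Matrix.trace, Complex.re_sum]
    refine Finset.sum_congr rfl fun i _ => ?_
    rw [Matrix.diag_apply, Matrix.diagonal_mul, hermOf_diag_apply, ← Complex.ofReal_mul, Complex.ofReal_re]
  rw [e1, e2, hermOf_add_diag]
  simp only [Prod.fst_add, Pi.add_apply, h32, hr2]
  rw [← hA]
  have e3 : ∀ T : ℝ, -(Vc * (lam / 4 * T - ∑ i, lam * a i ^ 3 * c.1 i - lam / 4 * ∑ i, a i ^ 4 + kap * ∑ i, c.1 i)) =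
     -(lam * Vc / 4) * T + Vc * (∑ i, (lam * a i ^ 3 * c.1 i + lam / 4 * a i ^ 4 - kap * c.1 i)) := by
    intro T
    rw [Finset.sum_sub_distrib, Finset.sum_add_distrib, ← Finset.mul_sum, ← Finset.mul_sum]; ring
  rw [e3]
  have e4 : ∑ i, (lam * a i ^ 3 * c.1 i + lam / 4 * a i ^ 4 - kap * c.1 i) + ∑ i, t i * c.1 i =
     ∑ i, (lam / 4 * a i ^ 4 - (lam * a i ^ 3 - kap) * a i) - ∑ i, t i * a i
       + ∑ i, (lam * a i ^ 3 - kap + t i) * (c.1 i + a i) := by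
    rw [← Finset.sum_add_distrib, ← Finset.sum_sub_distrib, ← Finset.sum_add_distrib]
    exact Finset.sum_congr rfl fun i _ => by ring
  linear_combination Vc * e4

theorem shift_int {N : ℕ} (G : HCoords N → ℝ) (d : HCoords N) : ∫ c, G (c + d) = ∫ c, G c := by
  have hinv : (volume : Measure (HCoords N)).IsAddRightInvariant := by
    have h1 : (volume : Measure (Fin N → ℝ)).IsAddHaarMeasure := inferInstance
    have h2 : (volume : Measure (OffIdx N → ℂ)).IsAddHaarMeasure := inferInstance
    have h3 : ((volume : Measure (Fin N → ℝ)).prod (volume : Measure (OffIdx N → ℂ))).IsAddHaarMeasure :=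
      inferInstance
    rw [Measure.volume_eq_prod]
    constructor
    intro g
    have := map_add_left_eq_self ((volume : Measure (Fin N → ℝ)).prod (volume : Measure (OffIdx N → ℂ))) g
    have e : (fun x : HCoords N => x + g) = fun x => g + x := funext fun x => add_comm x g
    rw [e]
    exact this
  exact integral_add_right_eq_self G d

theorem Zfun_eq {N : ℕ} {Vc lam kap : ℝ} (hl : 0 < lam) (Ev : Fin N → ℝ) (hE : ∀ i, 0 < Ev i)
    (t : Fin N → ℝ) :
    Zfun N Vc lam kap Ev (Matrix.diagonal fun i => (t i : ℂ)) =
    Real.exp (Vc * ∑ i, (lam / 4 * (√(Ev i) / √lam) ^ 4 - (Ev i ^ ((3:ℝ)/2) / √lam - kap) * (√(Ev i) / √lam))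
      + -(Vc * ∑ i, t i * (√(Ev i) / √lam))) *
      Ffun N Vc lam (fun i => (Ev i ^ ((3:ℝ)/2) / √lam - kap) + t i) := by
  unfold Zfun Ffun
  rw [← integral_const_mul]
  refine Eq.trans ?_ (shift_int _ ((fun i => √(Ev i) / √lam, 0) : HCoords N))
  refine integral_congr_ae (Filter.Eventually.of_forall fun c => ?_)
  beta_reduce
  rw [exponent_eq hl Ev hE, Real.exp_add]

end

section
open Filter Topology
theorem calc_abs {ι : Type*} [Fintype ι] (A B : ι → ℝ → ℝ) (hA : ∀ i, Differentiable ℝ (A i))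
    (hB : ∀ i, Differentiable ℝ (B i)) (p : ℝ → ℝ → ℝ) (hp : ∀ x y, p x y = ∑ i, A i x * B i y)
    (x0 y0 : ℝ) (hp0 : p x0 y0 ≠ 0) (L W : ℝ → ℝ → ℝ) (w : ℝ → ℝ) (w0 C0 C1 C2 : ℝ)
    (hL : ∀ᶠ q : ℝ × ℝ in 𝓝 (0, 0), L q.1 q.2 =
      C0 + C1 * q.1 + C2 * q.2 + Real.log (p (x0 + q.1) (y0 + q.2)) - W q.1 q.2)
    (hW : ∀ᶠ u in 𝓝 (0:ℝ), HasDerivAt (W u) (w u) 0) (hw : HasDerivAt w w0 0) :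
    deriv (fun u => deriv (fun v => L u v) 0) 0 =
      - (deriv (fun u => p u y0) x0 / p x0 y0) * (deriv (fun v => p x0 v) y0 / p x0 y0)
      + deriv (fun u => deriv (fun v => p u v) y0) x0 / p x0 y0 - w0 := by
  have hpx : ∀ x y, HasDerivAt (fun u => p u y) (∑ i, deriv (A i) x * B i y) x := by
    intro x y
    simp only [hp]
    exact HasDerivAt.fun_sum fun i _ => ((hA i x).hasDerivAt.mul_const _)
  have hpy : ∀ x y, HasDerivAt (fun v => p x v) (∑ i, A i x * deriv (B i) y) y := by
    intro x y
    simp only [hp]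
    exact HasDerivAt.fun_sum fun i _ => ((hB i y).hasDerivAt.const_mul _)
  have hpxy : HasDerivAt (fun u => ∑ i, A i u * deriv (B i) y0) (∑ i, deriv (A i) x0 * deriv (B i) y0) x0 :=
    HasDerivAt.fun_sum fun i _ => ((hA i x0).hasDerivAt.mul_const _)
  have e1 : (fun u => deriv (fun v => p u v) y0) = fun u => ∑ i, A i u * deriv (B i) y0 :=
    funext fun u => (hpy u y0).deriv
  rw [e1, hpxy.deriv, (hpx x0 y0).deriv, (hpy x0 y0).deriv]
  have hne : ∀ᶠ u in 𝓝 (0:ℝ), p (x0 + u) y0 ≠ 0 := by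
    have hc : ContinuousAt (fun u => p (x0 + u) y0) 0 := by
      have h1 : ContinuousAt (fun u => p u y0) (x0 + 0) := by
        rw [add_zero]; exact (hpx x0 y0).continuousAt
      exact ContinuousAt.comp (f := fun u : ℝ => x0 + u) h1 (by fun_prop)
    apply hc.eventually_ne
    simpa using hp0
  have hin : (fun u => deriv (fun v => L u v) 0) =ᶠ[𝓝 0]
      fun u => C2 + (∑ i, A i (x0 + u) * deriv (B i) y0) / p (x0 + u) y0 - w u := by
    have hc := hL.curry_nhds
    filter_upwards [hc, hne, hW] with u hu hn hwu
    have hu' : (fun v => L u v) =ᶠ[𝓝 0] fun v => C0 + C1 * u + C2 * v + Real.log (p (x0 + u) (y0 + v)) - W u v := hu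
    rw [hu'.deriv_eq]
    have d1 : HasDerivAt (fun v => p (x0 + u) (y0 + v)) (∑ i, A i (x0 + u) * deriv (B i) y0) 0 := by
      have := hpy (x0 + u) (y0 + 0)
      have := HasDerivAt.comp_const_add y0 0 this
      simpa using this
    have d2 := d1.log (by simpa using hn)
    have d3 : HasDerivAt (fun v => C0 + C1 * u + C2 * v) C2 0 := by
      simpa using ((hasDerivAt_id (0:ℝ)).const_mul C2).const_add (C0 + C1 * u)
    have := ((d3.fun_add d2).fun_sub hwu).deriv
    rw [this]; simp
  rw [hin.deriv_eq]
  have d1 : HasDerivAt (fun u => ∑ i, A i (x0 + u) * deriv (B i) y0) (∑ i, deriv (A i) x0 * deriv (B i) y0) 0 := by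
    have := HasDerivAt.comp_const_add x0 0 (f := fun u => ∑ i, A i u * deriv (B i) y0) (by simpa using hpxy)
    exact this
  have d2 : HasDerivAt (fun u => p (x0 + u) y0) (∑ i, deriv (A i) x0 * B i y0) 0 := by
    exact HasDerivAt.comp_const_add x0 0 (f := fun u => p u y0) (by simpa using hpx x0 y0)
  have d3 := (((d1.fun_div d2 (by simpa using hp0)).const_add C2).fun_sub hw).deriv
  rw [d3]
  simp only [add_zero]
  field_simp
  ring

theorem PN_sep {N : ℕ} {Vc lam : ℝ} (hk : 0 < lam * Vc / 4) (z : Fin N → ℝ) (a b : Fin N) (hab : a ≠ b) :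
    ∃ A B : Equiv.Perm (Fin N) → ℝ → ℝ, (∀ i, Differentiable ℝ (A i)) ∧ (∀ i, Differentiable ℝ (B i)) ∧
      ∀ x y, PNdet N Vc lam (Function.update (Function.update z a x) b y) = ∑ σ, A σ x * B σ y := by
  refine ⟨fun σ x => ((Equiv.Perm.sign σ : ℤ) : ℝ) *
      ((∏ i ∈ (Finset.univ.erase b).erase a, iteratedDeriv (σ i : ℕ) (Pint Vc lam) (z i)) *
      iteratedDeriv (σ a : ℕ) (Pint Vc lam) x),
    fun σ y => iteratedDeriv (σ b : ℕ) (Pint Vc lam) y, ?_, ?_, ?_⟩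
  · intro σ
    exact ((Pint_diff hk _).const_mul _).const_mul _
  · intro σ
    exact Pint_diff hk _
  · intro x y
    rw [PNdet, Matrix.det_apply']
    refine Finset.sum_congr rfl fun σ _ => ?_
    rw [mul_assoc]
    congr 1
    rw [← Finset.prod_erase_mul _ _ (Finset.mem_univ b),
      ← Finset.prod_erase_mul (Finset.univ.erase b) _ (Finset.mem_erase.2 ⟨hab, Finset.mem_univ a⟩)]
    simp only [Matrix.of_apply]
    rw [Function.update_self, Function.update_of_ne hab, Function.update_self]
    congr 2
    refine Finset.prod_congr rfl fun i hi => ?_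
    simp only [Finset.mem_erase] at hi
    rw [Function.update_of_ne hi.2.1, Function.update_of_ne hi.1]

theorem W_deriv {N : ℕ} (z da db : Fin N → ℝ) (hz : Function.Injective z) :
    ∃ w : ℝ → ℝ, (∀ᶠ u in 𝓝 (0:ℝ), HasDerivAt (fun v => Real.log (VD fun i => z i + u * da i + v * db i)) (w u) 0)
      ∧ HasDerivAt w (∑ i, ∑ j, if i < j then -((db j - db i) * (da j - da i)) / (z j - z i) ^ 2 else 0) 0 := by
  refine ⟨fun u => ∑ i, ∑ j, if i < j then (db j - db i) / (z j - z i + u * (da j - da i)) else 0, ?_, ?_⟩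
  · have hne : ∀ᶠ u in 𝓝 (0:ℝ), ∀ i j : Fin N, i < j → z j - z i + u * (da j - da i) ≠ 0 := by
      rw [eventually_all]; intro i
      rw [eventually_all]; intro j
      by_cases h : i < j
      · have hc : ContinuousAt (fun u : ℝ => z j - z i + u * (da j - da i)) 0 := by fun_prop
        have := hc.eventually_ne (y := 0) (by
          simp only [zero_mul, add_zero]
          exact sub_ne_zero.2 fun e => h.ne' (hz e))
        filter_upwards [this] with u hu _ using hu
      · exact Eventually.of_forall fun u hh => absurd hh h
    filter_upwards [hne] with u hu
    have hne2 : ∀ᶠ v in 𝓝 (0:ℝ), ∀ i j : Fin N, i < j → z j - z i + u * (da j - da i) + v * (db j - db i) ≠ 0 := by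
      rw [eventually_all]; intro i
      rw [eventually_all]; intro j
      by_cases h : i < j
      · have hc : ContinuousAt (fun v : ℝ => z j - z i + u * (da j - da i) + v * (db j - db i)) 0 := by fun_prop
        have := hc.eventually_ne (y := 0) (by
          simp only [zero_mul, add_zero]
          exact hu i j h)
        filter_upwards [this] with u hu _ using hu
      · exact Eventually.of_forall fun u hh => absurd hh h
    have hev : (fun v => Real.log (VD fun i => z i + u * da i + v * db i)) =ᶠ[𝓝 0]
        fun v => ∑ i, ∑ j, if i < j then Real.log (z j - z i + u * (da j - da i) + v * (db j - db i)) else 0 := by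
      filter_upwards [hne2] with v hv
      have hf : ∀ i j : Fin N, (if i < j then (z j + u * da j + v * db j) - (z i + u * da i + v * db i) else 1) =
          if i < j then z j - z i + u * (da j - da i) + v * (db j - db i) else 1 := by
        intro i j; split_ifs
        · ring
        · rfl
      rw [VD_ite]
      simp only [hf]
      have hn : ∀ i j : Fin N, (if i < j then z j - z i + u * (da j - da i) + v * (db j - db i) else 1) ≠ 0 := by
        intro i j; split_ifs with h
        · exact hv i j h
        · exact one_ne_zero
      rw [Real.log_prod fun i _ => Finset.prod_ne_zero_iff.2 fun j _ => hn i j]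
      refine Finset.sum_congr rfl fun i _ => ?_
      rw [Real.log_prod fun j _ => hn i j]
      refine Finset.sum_congr rfl fun j _ => ?_
      split_ifs
      · rfl
      · exact Real.log_one
    refine HasDerivAt.congr_of_eventuallyEq ?_ hev
    refine HasDerivAt.fun_sum fun i _ => HasDerivAt.fun_sum fun j _ => ?_
    split_ifs with h
    · have d : HasDerivAt (fun v : ℝ => z j - z i + u * (da j - da i) + v * (db j - db i)) (db j - db i) 0 := by
        simpa using ((hasDerivAt_id (0:ℝ)).mul_const (db j - db i)).const_add (z j - z i + u * (da j - da i))
      have := d.log (by simpa using hu i j h)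
      simpa using this
    · exact hasDerivAt_const _ _
  · refine HasDerivAt.fun_sum fun i _ => HasDerivAt.fun_sum fun j _ => ?_
    split_ifs with h
    · have hne : z j - z i ≠ 0 := sub_ne_zero.2 fun e => h.ne' (hz e)
      have d : HasDerivAt (fun v : ℝ => z j - z i + v * (da j - da i)) (da j - da i) 0 := by
        simpa using ((hasDerivAt_id (0:ℝ)).mul_const (da j - da i)).const_add (z j - z i)
      have := (hasDerivAt_const (0:ℝ) (db j - db i)).fun_div d (by simpa using hne)
      simpa using this
    · exact hasDerivAt_const _ _

theorem W_sum {N : ℕ} (z : Fin N → ℝ) (a b : Fin N) (hab : a ≠ b) :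
    (∑ i, ∑ j, if i < j then -(((Pi.single b 1 : Fin N → ℝ) j - (Pi.single b 1 : Fin N → ℝ) i) *
      ((Pi.single a 1 : Fin N → ℝ) j - (Pi.single a 1 : Fin N → ℝ) i)) / (z j - z i) ^ 2 else 0)
      = 1 / (z a - z b) ^ 2 := by
  have key : ∀ a b : Fin N, a < b → ∀ i j : Fin N, (if i < j then -(((Pi.single b 1 : Fin N → ℝ) j - (Pi.single b 1 : Fin N → ℝ) i) *
      ((Pi.single a 1 : Fin N → ℝ) j - (Pi.single a 1 : Fin N → ℝ) i)) / (z j - z i) ^ 2 else 0) =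
      if i = a then (if j = b then 1 / (z a - z b) ^ 2 else 0) else 0 := by
    intro a b h i j
    have e : (z a - z b) ^ 2 = (z b - z a) ^ 2 := by ring
    simp only [Pi.single_apply]
    by_cases h1 : i = a <;> by_cases h2 : j = b <;> by_cases h3 : j = a <;> by_cases h4 : i = b <;>
      by_cases h5 : i < j <;> simp [h1, h2, h3, h4, h5] <;> grind
  rcases lt_or_gt_of_ne hab with h | h
  · simp only [key a b h]; simp
  · have := key b a h
    have e : (z a - z b) ^ 2 = (z b - z a) ^ 2 := by ring
    simp only [mul_comm] at this ⊢
    simp only [this]; simp [e]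

end

section
open Filter Topology
theorem main_aux
    (N : ℕ) (Vc lam kap : ℝ) (hV : 0 < Vc) (hlam : 0 < lam)
    (Ev : Fin N → ℝ) (hE : ∀ i, 0 < Ev i) (z : Fin N → ℝ)
    (hzd : ∀ i, z i = Ev i ^ ((3 : ℝ) / 2) / Real.sqrt lam - kap) (hz : Function.Injective z)
    (a b : Fin N) (hab : a ≠ b) :
    deriv (fun u : ℝ => deriv (fun v : ℝ => Real.log (Zfun N Vc lam kap Ev
        (Matrix.diagonal fun i =>
          ((Function.update (Function.update (0 : Fin N → ℝ) a u) b v) i : ℂ)))) 0) 0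
    = - (deriv (fun u => PNdet N Vc lam (Function.update z a u)) (z a) / PNdet N Vc lam z)
        * (deriv (fun u => PNdet N Vc lam (Function.update z b u)) (z b) / PNdet N Vc lam z)
      + deriv (fun u : ℝ => deriv (fun v : ℝ => PNdet N Vc lam
            (Function.update (Function.update z a u) b v)) (z b)) (z a) / PNdet N Vc lam z
      - 1 / (z a - z b) ^ 2 := by
  have hk : 0 < lam * Vc / 4 := by positivity
  obtain ⟨A, B, hA, hB, hAB⟩ := PN_sep hk z a b hab
  obtain ⟨w, hw1, hw2⟩ := W_deriv z (Pi.single a 1) (Pi.single b 1) hz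
  rw [W_sum z a b hab] at hw2
  obtain ⟨K, hK, hF⟩ := Fmain N hV hlam
  have hnz : ∀ s : Fin N → ℝ, Function.Injective s → PNdet N Vc lam s ≠ 0 := by
    intro s hs h
    have := (hF s hs).2
    rw [h] at this; simp at this
  have up0 : Function.update (Function.update z a (z a)) b (z b) = z := by simp
  have upa : ∀ u, Function.update (Function.update z a u) b (z b) = Function.update z a u := by
    intro u
    funext i
    by_cases h : i = b
    · subst h; simp [Function.update_of_ne hab.symm]
    · simp [Function.update_of_ne h]
  have upb : ∀ v, Function.update (Function.update z a (z a)) b v = Function.update z b v := by simp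
  have tri : ∀ u v, (Function.update (Function.update (0 : Fin N → ℝ) a u) b v) =
      fun i => u * (Pi.single a 1 : Fin N → ℝ) i + v * (Pi.single b 1 : Fin N → ℝ) i := by
    intro u v
    funext i
    by_cases h : i = b
    · subst h; simp [hab.symm]
    · by_cases h' : i = a
      · subst h'; simp [h]
      · simp [h, h']
  have sri : ∀ u v, (fun i => z i + u * (Pi.single a 1 : Fin N → ℝ) i + v * (Pi.single b 1 : Fin N → ℝ) i) =
      Function.update (Function.update z a (z a + u)) b (z b + v) := by
    intro u v
    funext i
    by_cases h : i = b
    · subst h; simp [hab.symm]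
    · by_cases h' : i = a
      · subst h'; simp [h]
      · simp [h, h']
  have hinj : ∀ᶠ q : ℝ × ℝ in 𝓝 (0, 0), Function.Injective
      (fun i => z i + q.1 * (Pi.single a 1 : Fin N → ℝ) i + q.2 * (Pi.single b 1 : Fin N → ℝ) i) := by
    have : ∀ᶠ q : ℝ × ℝ in 𝓝 (0, 0), ∀ i j : Fin N, i ≠ j →
      (z i + q.1 * (Pi.single a 1 : Fin N → ℝ) i + q.2 * (Pi.single b 1 : Fin N → ℝ) i)
       - (z j + q.1 * (Pi.single a 1 : Fin N → ℝ) j + q.2 * (Pi.single b 1 : Fin N → ℝ) j) ≠ 0 := by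
      rw [eventually_all]; intro i
      rw [eventually_all]; intro j
      by_cases h : i = j
      · exact Eventually.of_forall fun u hh => absurd h hh
      · have hc : ContinuousAt (fun q : ℝ × ℝ => (z i + q.1 * (Pi.single a 1 : Fin N → ℝ) i + q.2 * (Pi.single b 1 : Fin N → ℝ) i)
           - (z j + q.1 * (Pi.single a 1 : Fin N → ℝ) j + q.2 * (Pi.single b 1 : Fin N → ℝ) j)) (0, 0) := by fun_prop
        have := hc.eventually_ne (y := 0) (by
          simp only [zero_mul, add_zero]
          exact sub_ne_zero.2 fun e => h (hz e))
        filter_upwards [this] with u hu _ using hu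
    filter_upwards [this] with q hq i j hij
    by_contra h
    exact hq i j h (sub_eq_zero.2 hij)
  have hmain := calc_abs A B hA hB
    (fun x y => PNdet N Vc lam (Function.update (Function.update z a x) b y)) hAB (z a) (z b)
    (by beta_reduce; rw [up0]; exact hnz z hz)
    (fun u v => Real.log (Zfun N Vc lam kap Ev
        (Matrix.diagonal fun i =>
          ((Function.update (Function.update (0 : Fin N → ℝ) a u) b v) i : ℂ))))
    (fun u v => Real.log (VD fun i => z i + u * (Pi.single a 1 : Fin N → ℝ) i + v * (Pi.single b 1 : Fin N → ℝ) i))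
    w (1 / (z a - z b) ^ 2)
    (Vc * ∑ i, (lam / 4 * (√(Ev i) / √lam) ^ 4 - (Ev i ^ ((3:ℝ)/2) / √lam - kap) * (√(Ev i) / √lam)) + Real.log K)
    (-(Vc * (√(Ev a) / √lam))) (-(Vc * (√(Ev b) / √lam)))
    (by
      filter_upwards [hinj] with q hq
      rw [Zfun_eq hlam Ev hE]
      simp only [← hzd]
      have es : (fun i => z i + Function.update (Function.update (0 : Fin N → ℝ) a q.1) b q.2 i) =
        fun i => z i + q.1 * (Pi.single a 1 : Fin N → ℝ) i + q.2 * (Pi.single b 1 : Fin N → ℝ) i := by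
        rw [tri]; funext i; ring
      have et : ∑ i, Function.update (Function.update (0 : Fin N → ℝ) a q.1) b q.2 i * (√(Ev i) / √lam) =
          q.1 * (√(Ev a) / √lam) + q.2 * (√(Ev b) / √lam) := by
        rw [tri]
        simp only [add_mul, Finset.sum_add_distrib, Pi.single_apply]
        simp
      rw [es, et, (hF _ hq).1, Real.log_mul (Real.exp_ne_zero _) (mul_ne_zero hK.ne' (hF _ hq).2.ne'),
        Real.log_exp, Real.log_mul hK.ne' (hF _ hq).2.ne', Real.log_div (hnz _ hq) (VD_ne hq), ← sri]
      ring)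
    hw1 hw2
  simp only [upa, upb, up0, Function.update_eq_self] at hmain
  exact hmain

end

/-- Exact 2-boundary 2-point function `G_{|a|b|}`: with
`z_j = E_{j−1}^{3/2}/√λ − κ` and `Z_diag(t) = Z[diag t]`, for `a ≠ b`,
`∂²/∂t_a∂t_b log Z_diag |_{t=0}
  = −(∂_aP_N)(z)(∂_bP_N)(z)/P_N(z)² + (∂_a∂_bP_N)(z)/P_N(z)
    − λ/(E_{a−1}^{3/2} − E_{b−1}^{3/2})²`. -/
theorem two_point_function_two_boundaries_exact
    (N : ℕ) (hN : 1 ≤ N) (Vc lam kap : ℝ) (hV : 0 < Vc) (hlam : 0 < lam)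
    (Ev : Fin N → ℝ) (hE : ∀ i, 0 < Ev i) (hEdist : Function.Injective Ev)
    (a b : Fin N) (hab : a ≠ b) :
    deriv (fun u : ℝ => deriv (fun v : ℝ => Real.log (Zfun N Vc lam kap Ev
        (Matrix.diagonal fun i =>
          ((Function.update (Function.update (0 : Fin N → ℝ) a u) b v) i : ℂ)))) 0) 0
    = - (deriv (fun u => PNdet N Vc lam
            (Function.update (fun j => Ev j ^ ((3 : ℝ) / 2) / Real.sqrt lam - kap) a u))
          (Ev a ^ ((3 : ℝ) / 2) / Real.sqrt lam - kap)
          / PNdet N Vc lam (fun j => Ev j ^ ((3 : ℝ) / 2) / Real.sqrt lam - kap))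
        * (deriv (fun u => PNdet N Vc lam
            (Function.update (fun j => Ev j ^ ((3 : ℝ) / 2) / Real.sqrt lam - kap) b u))
          (Ev b ^ ((3 : ℝ) / 2) / Real.sqrt lam - kap)
          / PNdet N Vc lam (fun j => Ev j ^ ((3 : ℝ) / 2) / Real.sqrt lam - kap))
      + deriv (fun u : ℝ => deriv (fun v : ℝ => PNdet N Vc lam
            (Function.update (Function.update
              (fun j => Ev j ^ ((3 : ℝ) / 2) / Real.sqrt lam - kap) a u) b v))
          (Ev b ^ ((3 : ℝ) / 2) / Real.sqrt lam - kap))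
          (Ev a ^ ((3 : ℝ) / 2) / Real.sqrt lam - kap)
        / PNdet N Vc lam (fun j => Ev j ^ ((3 : ℝ) / 2) / Real.sqrt lam - kap)
      - lam / (Ev a ^ ((3 : ℝ) / 2) - Ev b ^ ((3 : ℝ) / 2)) ^ 2 := by
  have hinj : Function.Injective fun j => Ev j ^ ((3 : ℝ) / 2) / Real.sqrt lam - kap := by
    intro i j h
    have hs : Real.sqrt lam ≠ 0 := (Real.sqrt_pos.2 hlam).ne'
    have h1 : Ev i ^ ((3 : ℝ) / 2) = Ev j ^ ((3 : ℝ) / 2) := by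
      have h2 := sub_left_injective h
      exact (div_left_inj' hs).1 h2
    exact hEdist ((Real.rpow_left_inj (hE i).le (hE j).le (by norm_num)).1 h1)
  have h := main_aux N Vc lam kap hV hlam Ev hE
    (fun j => Ev j ^ ((3 : ℝ) / 2) / Real.sqrt lam - kap) (fun _ => rfl) hinj a b hab
  have e : 1 / ((Ev a ^ ((3 : ℝ) / 2) / Real.sqrt lam - kap) - (Ev b ^ ((3 : ℝ) / 2) / Real.sqrt lam - kap)) ^ 2
      = lam / (Ev a ^ ((3 : ℝ) / 2) - Ev b ^ ((3 : ℝ) / 2)) ^ 2 := by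
    have : (Ev a ^ ((3 : ℝ) / 2) / Real.sqrt lam - kap) - (Ev b ^ ((3 : ℝ) / 2) / Real.sqrt lam - kap)
      = (Ev a ^ ((3 : ℝ) / 2) - Ev b ^ ((3 : ℝ) / 2)) / Real.sqrt lam := by ring
    rw [this, div_pow, Real.sq_sqrt hlam.le, one_div_div]
  beta_reduce at h
  rw [e] at h
  exact h
end
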